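/- arXiv:2301.05003 — 7 statements merged into one kernel-verified Lean document; each statement's English description precedes it below -/
import Mathlib

section
/- Let p and q be real numbers with 1 < p < ∞ and 1 ≤ q < ∞, and suppose that p > 2 or q < 2. Then the pair (L_p[0,1], L_q[0,1]) of real Lebesgue spaces over the interval [0,1] with Lebesgue measure fails the compact perturbation property. -/
open Filter Topology MeasureTheory
open scoped ENNReal

/-- A bounded linear operator attains its norm if `‖T x‖ = ‖T‖` for some `x` in the
closed unit ball. -/
def NormAttains {X Y : Type*} [NormedAddCommGroup X] [NormedSpace ℝ X]
    [NormedAddCommGroup Y] [NormedSpace ℝ Y] (T : X →L[ℝ] Y) : Prop :=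
  ∃ x : X, ‖x‖ ≤ 1 ∧ ‖T x‖ = ‖T‖

/-- The pair `(X, Y)` has the compact perturbation property. -/
def CPP (X Y : Type*) [NormedAddCommGroup X] [NormedSpace ℝ X]
    [NormedAddCommGroup Y] [NormedSpace ℝ Y] : Prop :=
  ∀ T K : X →L[ℝ] Y, IsCompactOperator ⇑K → ‖T‖ < ‖T + K‖ → NormAttains (T + K)

/-- The real sequence space `ℓ²`. -/
abbrev RealEllTwo : Type := lp (fun _ : ℕ => ℝ) 2

namespace RealEllTwo

/-- The standard unit vectors of `ℓ²`. -/
noncomputable def basisVec (n : ℕ) : RealEllTwo := lp.single 2 n (1 : ℝ)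

lemma basisVec_apply (n m : ℕ) : basisVec n m = if m = n then 1 else 0 := by
  simp [basisVec, lp.single_apply, Pi.single_apply]

lemma coord_add (c d : RealEllTwo) (n : ℕ) : (c + d) n = c n + d n := rfl

lemma coord_smul (a : ℝ) (c : RealEllTwo) (n : ℕ) : (a • c) n = a * c n := rfl

lemma norm_sq_hasSum (c : RealEllTwo) : HasSum (fun n => (c n) ^ 2) (‖c‖ ^ 2) := by
  simpa using lp.hasSum_norm (p := 2) (by norm_num) c

lemma memℓp_mul (w : ℕ → ℝ) (hw : ∀ n, |w n| ≤ 1) (c : RealEllTwo) :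
    Memℓp (fun n => w n * c n) 2 := by
  refine (lp.memℓp c).mono' fun n => ?_
  rw [norm_mul]
  exact mul_le_of_le_one_left (norm_nonneg _) (hw n)

/-- The diagonal operator on `ℓ²` with the given weights, all of absolute value at most `1`. -/
noncomputable def diagonal (w : ℕ → ℝ) (hw : ∀ n, |w n| ≤ 1) : RealEllTwo →L[ℝ] RealEllTwo :=
  LinearMap.mkContinuous
    { toFun := fun c => ⟨fun n => w n * c n, memℓp_mul w hw c⟩
      map_add' := fun c d => by ext n; exact mul_add _ _ _
      map_smul' := fun a c => by ext n; simp [mul_left_comm] } 1 fun c => by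
    rw [one_mul]
    refine abs_le_of_sq_le_sq' ?_ (norm_nonneg _) |>.2
    refine hasSum_le (fun n => ?_) (norm_sq_hasSum _) (norm_sq_hasSum c)
    have h : (w n) ^ 2 ≤ 1 := (sq_le_one_iff_abs_le_one _).2 (hw n)
    simpa [mul_pow] using mul_le_of_le_one_left (sq_nonneg (c n)) h

lemma diagonal_apply (w : ℕ → ℝ) (hw : ∀ n, |w n| ≤ 1) (c : RealEllTwo) (n : ℕ) :
    diagonal w hw c n = w n * c n := rfl

lemma norm_diagonal_apply_le (w : ℕ → ℝ) (hw : ∀ n, |w n| ≤ 1) (c : RealEllTwo) :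
    ‖diagonal w hw c‖ ≤ ‖c‖ := by
  simpa using (diagonal w hw).le_of_opNorm_le (LinearMap.mkContinuous_norm_le _ zero_le_one _) c

/-- A diagonal contraction strictly decreases the norm of vectors charging a coordinate whose
weight has absolute value less than one. -/
lemma apply_eq_zero_of_norm_le_norm_diagonal {w : ℕ → ℝ} {hw : ∀ n, |w n| ≤ 1} {c : RealEllTwo}
    (h : ‖c‖ ≤ ‖diagonal w hw c‖) {n : ℕ} (hn : |w n| < 1) : c n = 0 := by
  by_contra hc
  have hlt : ‖diagonal w hw c‖ ^ 2 < ‖c‖ ^ 2 := by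
    refine hasSum_lt (i := n) (fun m => ?_) ?_ (norm_sq_hasSum _) (norm_sq_hasSum c)
    · have h : (w m) ^ 2 ≤ 1 := (sq_le_one_iff_abs_le_one _).2 (hw m)
      simpa [diagonal_apply, mul_pow] using mul_le_of_le_one_left (sq_nonneg (c m)) h
    · have h : (w n) ^ 2 < 1 := (sq_lt_one_iff_abs_lt_one _).2 hn
      simpa [diagonal_apply, mul_pow] using mul_lt_of_lt_one_left (by positivity) h
  exact hlt.not_ge (pow_le_pow_left₀ (norm_nonneg _) h 2)

/-- The weights `n / (n + 1)`. -/
noncomputable def weight (n : ℕ) : ℝ := n / (n + 1)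

lemma weight_nonneg (n : ℕ) : 0 ≤ weight n := by unfold weight; positivity

lemma weight_lt_one (n : ℕ) : weight n < 1 := by
  unfold weight
  rw [div_lt_one (by positivity)]
  linarith

lemma abs_weight_lt_one (n : ℕ) : |weight n| < 1 := by
  rw [abs_of_nonneg (weight_nonneg n)]
  exact weight_lt_one n

lemma tendsto_weight : Tendsto weight atTop (𝓝 1) := tendsto_natCast_div_add_atTop 1

/-- The diagonal operator with weights `n / (n + 1)`. -/
noncomputable def weightOp : RealEllTwo →L[ℝ] RealEllTwo :=
  diagonal weight fun n => (abs_weight_lt_one n).le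

/-- The coordinate projection onto the zeroth coordinate. -/
noncomputable def headOp : RealEllTwo →L[ℝ] RealEllTwo :=
  (innerSL ℝ (basisVec 0)).smulRight (basisVec 0)

lemma inner_basisVec (n : ℕ) (c : RealEllTwo) : inner ℝ (basisVec n) c = c n := by
  simp [basisVec, lp.inner_single_left]

lemma headOp_apply (c : RealEllTwo) : headOp c = c 0 • basisVec 0 := by
  simp [headOp, inner_basisVec]

lemma isCompactOperator_headOp : IsCompactOperator headOp := by
  refine ⟨(fun t : ℝ => t • basisVec 0) '' Metric.closedBall 0 1,
    (isCompact_closedBall 0 1).image (by fun_prop), ?_⟩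
  filter_upwards [(innerSL ℝ (basisVec 0)).continuous.continuousAt.preimage_mem_nhds
    (Metric.closedBall_mem_nhds _ one_pos)] with c hc
  exact ⟨_, by simpa using hc, rfl⟩

lemma weightOp_add_headOp : weightOp + headOp =
    diagonal (fun n => if n = 0 then 1 else weight n)
      (fun n => by split_ifs <;> simp [(abs_weight_lt_one n).le]) := by
  ext c n
  rcases eq_or_ne n 0 with rfl | hn
  · simp [headOp_apply, weightOp, diagonal_apply, basisVec_apply, weight, coord_add, coord_smul]
  · simp [headOp_apply, weightOp, diagonal_apply, basisVec_apply, hn, coord_add, coord_smul]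

lemma norm_weightOp_add_headOp_apply_le (c : RealEllTwo) : ‖(weightOp + headOp) c‖ ≤ ‖c‖ := by
  rw [weightOp_add_headOp]
  exact norm_diagonal_apply_le _ _ c

lemma weightOp_eq_zero_of_norm_le {c : RealEllTwo} (h : ‖c‖ ≤ ‖(weightOp + headOp) c‖) :
    weightOp c = 0 := by
  rw [weightOp_add_headOp] at h
  ext n
  rcases eq_or_ne n 0 with rfl | hn
  · simp [weightOp, diagonal_apply, weight]
  · have := apply_eq_zero_of_norm_le_norm_diagonal h (n := n) (by simpa [hn] using abs_weight_lt_one n)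
    simp [weightOp, diagonal_apply, this]

lemma norm_basisVec (n : ℕ) : ‖basisVec n‖ = 1 := by
  simp [basisVec, lp.norm_single]

lemma weightOp_basisVec (n : ℕ) : weightOp (basisVec n) = weight n • basisVec n := by
  ext m
  by_cases h : m = n
  · subst h; simp [weightOp, diagonal_apply, basisVec_apply]
  · simp [weightOp, diagonal_apply, basisVec_apply, h]

/-- The unit vectors `(δ₀ + δₙ₊₁) / √2`. -/
noncomputable def pairVec (n : ℕ) : RealEllTwo := (√2)⁻¹ • (basisVec 0 + basisVec (n + 1))

lemma norm_pairVec (n : ℕ) : ‖pairVec n‖ = 1 := by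
  have h : ‖basisVec 0 + basisVec (n + 1)‖ ^ 2 = 2 := by
    rw [norm_add_sq_real, inner_basisVec, norm_basisVec, norm_basisVec, basisVec_apply]
    norm_num
  rw [pairVec, norm_smul, ← Real.sqrt_sq (norm_nonneg (basisVec 0 + basisVec (n + 1))), h,
    Real.norm_of_nonneg (by positivity)]
  exact inv_mul_cancel₀ (by positivity)

lemma weightOp_add_headOp_pairVec (n : ℕ) : (weightOp + headOp) (pairVec n) =
    pairVec n - ((1 - weight (n + 1)) * (√2)⁻¹) • basisVec (n + 1) := by
  have h0 : weightOp (basisVec 0) = 0 := by simp [weightOp_basisVec, weight]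
  simp only [pairVec, add_apply, map_smul, map_add, h0, weightOp_basisVec,
    headOp_apply, basisVec_apply]
  simp
  module

lemma norm_weightOp_apply_le (c : RealEllTwo) : ‖weightOp c‖ ≤ ‖c‖ := norm_diagonal_apply_le _ _ c

lemma norm_headOp_apply_le (c : RealEllTwo) : ‖headOp c‖ ≤ ‖c‖ := by
  rw [headOp_apply, norm_smul, norm_basisVec, mul_one]
  exact lp.norm_apply_le_norm two_ne_zero c 0

lemma inner_weightOp_right (c d : RealEllTwo) :
    inner ℝ c (weightOp d) = inner ℝ (weightOp c) d := by
  rw [lp.inner_eq_tsum, lp.inner_eq_tsum]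
  refine tsum_congr fun n => ?_
  simp only [weightOp, diagonal_apply, RCLike.inner_apply, conj_trivial]
  ring

lemma inner_headOp_right (c d : RealEllTwo) : inner ℝ c (headOp d) = inner ℝ (headOp c) d := by
  rw [headOp_apply, headOp_apply, real_inner_smul_left, real_inner_smul_right, inner_basisVec,
    real_inner_comm, inner_basisVec, mul_comm]

end RealEllTwo

open RealEllTwo in
/-- If the perturbed diagonal operator on `ℓ²` is sandwiched between two contractions `A`, `B` which
shrink both of its parts, but not the pair vectors, then the pair of spaces fails the compact
perturbation property. -/
theorem not_CPP_of_factorization {X Y : Type*} [NormedAddCommGroup X] [NormedSpace ℝ X]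
    [NormedAddCommGroup Y] [NormedSpace ℝ Y] (A : X →L[ℝ] RealEllTwo) (B : RealEllTwo →L[ℝ] Y)
    (hA : ∀ f, ‖A f‖ ≤ ‖f‖) (hB : ∀ c, ‖B c‖ ≤ ‖c‖) {κ : ℝ} (hκ0 : 0 ≤ κ) (hκ : κ < 1)
    (hT : ∀ f, ‖B (weightOp (A f))‖ ≤ κ * ‖f‖) (hK : ∀ f, ‖B (headOp (A f))‖ ≤ κ * ‖f‖)
    (hv : ∀ n, ∃ f, ‖f‖ ≤ 1 ∧ A f = pairVec n) (hBv : ∀ n, ‖B (pairVec n)‖ = 1) :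
    ¬ CPP X Y := by
  intro h
  set T : X →L[ℝ] Y := B ∘L weightOp ∘L A
  set K : X →L[ℝ] Y := B ∘L headOp ∘L A
  have hS : ∀ f, (T + K) f = B ((weightOp + headOp) (A f)) := fun f => by simp [T, K]
  have hSle : ∀ f, ‖(T + K) f‖ ≤ ‖f‖ := fun f => by
    rw [hS]
    exact (hB _).trans ((norm_weightOp_add_headOp_apply_le _).trans (hA f))
  have hnorm : ‖T + K‖ = 1 := by
    refine le_antisymm (ContinuousLinearMap.opNorm_le_bound _ zero_le_one
      fun f => by simpa using hSle f) ?_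
    have hlow : ∀ n : ℕ, weight (n + 1) ≤ ‖T + K‖ := by
      intro n
      obtain ⟨f, hf, hAf⟩ := hv n
      have h1 : ‖(T + K) f‖ ≤ ‖T + K‖ := (T + K).unit_le_opNorm f hf
      rw [hS, hAf, weightOp_add_headOp_pairVec, map_sub] at h1
      have h2 := norm_sub_norm_le (B (pairVec n))
        (B (((1 - weight (n + 1)) * (√2)⁻¹) • basisVec (n + 1)))
      have h3 := hB (((1 - weight (n + 1)) * (√2)⁻¹) • basisVec (n + 1))
      have hw := weight_lt_one (n + 1)
      have h4 : (√2)⁻¹ ≤ 1 := inv_le_one_of_one_le₀ (Real.one_le_sqrt.2 one_le_two)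
      rw [norm_smul, norm_basisVec, mul_one, Real.norm_of_nonneg (by
        have : 0 ≤ 1 - weight (n + 1) := by linarith
        positivity)] at h3
      have h5 : (1 - weight (n + 1)) * (√2)⁻¹ ≤ 1 - weight (n + 1) :=
        mul_le_of_le_one_right (by linarith) h4
      rw [hBv] at h2
      linarith
    exact le_of_tendsto' (tendsto_weight.comp (tendsto_add_atTop_nat 1)) hlow
  have hTnorm : ‖T‖ ≤ κ := ContinuousLinearMap.opNorm_le_bound _ hκ0 hT
  have hKc : IsCompactOperator K :=
    (isCompactOperator_headOp.comp_clm A).clm_comp B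
  obtain ⟨f, hf, hfn⟩ := h T K hKc (by rw [hnorm]; linarith)
  rw [hnorm] at hfn
  have h1 : ‖A f‖ ≤ ‖(weightOp + headOp) (A f)‖ := by
    have := hB ((weightOp + headOp) (A f))
    rw [← hS, hfn] at this
    exact (hA f).trans (hf.trans this)
  have h2 := hK f
  have h3 : (T + K) f = B (headOp (A f)) := by
    rw [hS, add_apply, weightOp_eq_zero_of_norm_le h1, zero_add]
  rw [← h3, hfn] at h2
  have := mul_le_mul_of_nonneg_left hf hκ0
  linarith

open ProbabilityTheory

/-- The unit interval carries a sequence of independent standard Gaussian variables. -/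
lemma exists_iid_gaussian_Icc : ∃ g : ℕ → ℝ → ℝ, (∀ n, Measurable (g n)) ∧
    (∀ n, HasLaw (g n) (gaussianReal 0 1) (volume.restrict (Set.Icc (0 : ℝ) 1))) ∧
    iIndepFun g (volume.restrict (Set.Icc (0 : ℝ) 1)) := by
  obtain ⟨f, hf, hmap⟩ :=
    (Measure.infinitePi fun _ : ℕ => gaussianReal 0 1).exists_measurable_map_eq
  have hg : Measurable fun x : ℝ => f (Set.projIcc 0 1 zero_le_one x) :=
    hf.comp continuous_projIcc.measurable
  have hlaw : (volume.restrict (Set.Icc (0 : ℝ) 1)).map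
      (fun x : ℝ => f (Set.projIcc 0 1 zero_le_one x)) =
      Measure.infinitePi fun _ : ℕ => gaussianReal 0 1 := by
    have := unitInterval.measurePreserving_coe.map_eq
    change Measure.map _ _ = volume.restrict (Set.Icc (0 : ℝ) 1) at this
    rw [← this, Measure.map_map hg measurable_subtype_coe, ← hmap]
    congr 1
    ext1 x
    simp
  have hm : ∀ n, Measurable fun x : ℝ => f (Set.projIcc 0 1 zero_le_one x) n :=
    fun n => (measurable_pi_apply n).comp hg
  have hl : ∀ n, HasLaw (fun x : ℝ => f (Set.projIcc 0 1 zero_le_one x) n) (gaussianReal 0 1)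
      (volume.restrict (Set.Icc (0 : ℝ) 1)) := fun n =>
    (measurePreserving_eval_infinitePi (fun _ : ℕ => gaussianReal 0 1) n).hasLaw.comp
      ⟨hg.aemeasurable, hlaw⟩
  refine ⟨fun n x => f (Set.projIcc 0 1 zero_le_one x) n, hm, hl, ?_⟩
  have : IsProbabilityMeasure (volume.restrict (Set.Icc (0 : ℝ) 1)) := ⟨by simp⟩
  rw [iIndepFun_iff_map_fun_eq_infinitePi_map hm, hlaw]
  exact congrArg _ (funext fun n => ((hl n).map_eq).symm)

section GaussianEmbedding

variable {Ω : Type*} [MeasurableSpace Ω] {μ : Measure Ω} [IsProbabilityMeasure μ] {g : ℕ → Ω → ℝ}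

lemma hasLaw_sum_mul_gaussian (hm : ∀ n, Measurable (g n))
    (hg : ∀ n, HasLaw (g n) (gaussianReal 0 1) μ) (hi : iIndepFun g μ) (c : ℕ → ℝ)
    (s : Finset ℕ) : HasLaw (∑ n ∈ s, fun ω => c n * g n ω)
      (gaussianReal 0 (Real.toNNReal (∑ n ∈ s, c n ^ 2))) μ := by
  induction s using Finset.induction_on with
  | empty =>
    simpa using hasLaw_dirac_of_ae_eq (P := μ) (X := (0 : Ω → ℝ)) (x := 0) (ae_of_all _ fun _ => rfl)
  | insert n s hn ih =>
    have hmc : ∀ n, Measurable fun ω => c n * g n ω := fun n => (hm n).const_mul _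
    have hic : iIndepFun (fun n ω => c n * g n ω) μ :=
      hi.comp (fun n x => c n * x) fun n => by fun_prop
    have h1 := gaussianReal_const_mul (hg n) (c n)
    have h2 := hic.indepFun_finsetSum_of_notMem hmc hn
    refine ⟨(by fun_prop), ?_⟩
    rw [Finset.sum_insert hn, Finset.sum_insert hn, add_comm,
      gaussianReal_add_gaussianReal_of_indepFun h2 ih.map_eq h1.map_eq,
      add_comm (c n ^ 2), Real.toNNReal_add (by positivity) (by positivity)]
    congr 1
    · simp
    · ext; simp [Real.toNNReal_of_nonneg, sq_nonneg]

lemma eLpNorm_gaussianReal (p : ℝ≥0∞) {v : ℝ} (hv : 0 ≤ v) :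
    eLpNorm id p (gaussianReal 0 v.toNNReal) =
      ENNReal.ofReal √v * eLpNorm id p (gaussianReal 0 1) := by
  have h : gaussianReal 0 v.toNNReal = (gaussianReal 0 1).map (√v * ·) := by
    rw [gaussianReal_map_const_mul]
    congr 1
    · simp
    · ext; simp [hv]
  rw [h, eLpNorm_map_measure (by fun_prop) (by fun_prop)]
  have := eLpNorm_const_smul (√v) (id : ℝ → ℝ) p (gaussianReal 0 1)
  rw [Real.enorm_of_nonneg (by positivity)] at this
  exact this

lemma eLpNorm_gaussianReal_ne_zero {p : ℝ≥0∞} (hp : p ≠ 0) :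
    eLpNorm id p (gaussianReal 0 1) ≠ 0 := by
  have := nullSingletonClass_gaussianReal (μ := 0) (v := 1) one_ne_zero
  rw [Ne, eLpNorm_eq_zero_iff aestronglyMeasurable_id hp]
  intro h
  have h0 : gaussianReal 0 1 {x : ℝ | ¬ id x = (0 : ℝ → ℝ) x} = 0 := h
  have h1 : gaussianReal 0 1 (Set.univ : Set ℝ) = 0 := by
    refine measure_mono_null (t := {x : ℝ | ¬ id x = (0 : ℝ → ℝ) x} ∪ {0}) (fun x _ => ?_)
      (measure_union_null h0 (measure_singleton _))
    by_cases hx : x = 0 <;> simp [hx]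
  simp at h1

/-- `ℓ²` embeds isometrically into every `L_p` space carrying a sequence of independent standard
Gaussian variables. -/
lemma exists_linearIsometry_Lp (hm : ∀ n, Measurable (g n))
    (hg : ∀ n, HasLaw (g n) (gaussianReal 0 1) μ) (hi : iIndepFun g μ)
    (p : ℝ≥0∞) [Fact (1 ≤ p)] (hp : p ≠ ∞) : Nonempty (RealEllTwo →ₗᵢ[ℝ] Lp ℝ p μ) := by
  have hid : MemLp id p (gaussianReal 0 1) := by
    exact memLp_id_gaussianReal' p hp
  set γ := (eLpNorm id p (gaussianReal 0 1)).toReal with hγ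
  have hγ0 : 0 < γ := ENNReal.toReal_pos
    (eLpNorm_gaussianReal_ne_zero (zero_lt_one.trans_le Fact.out).ne') hid.eLpNorm_ne_top
  have hgp : ∀ n, MemLp (g n) p μ := fun n => by
    have := hid
    rw [← (hg n).map_eq] at this
    exact this.comp_of_map (hm n).aemeasurable
  set F : (ℕ →₀ ℝ) →ₗ[ℝ] Lp ℝ p μ := Finsupp.linearCombination ℝ fun n => (hgp n).toLp
  set e : (ℕ →₀ ℝ) →ₗ[ℝ] RealEllTwo := Finsupp.linearCombination ℝ RealEllTwo.basisVec
  have he : ∀ c, ‖e c‖ = √(∑ n ∈ c.support, c n ^ 2) := fun c => by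
    have hs := RealEllTwo.norm_sq_hasSum (e c)
    have hc : ∀ n, e c n = c n := fun n => by
      rw [← RealEllTwo.inner_basisVec]
      simp [e, Finsupp.linearCombination_apply, Finsupp.sum, inner_sum, inner_smul_right,
        RealEllTwo.inner_basisVec, RealEllTwo.basisVec_apply]
      tauto
    simp only [hc] at hs
    rw [← hs.unique (hasSum_sum_of_ne_finset_zero fun n hn => by simpa using hn),
      Real.sqrt_sq (norm_nonneg _)]
  have hF : ∀ c, ‖F c‖ = γ * ‖e c‖ := fun c => by
    have hae : F c =ᵐ[μ] ∑ n ∈ c.support, fun ω => c n * g n ω := by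
      simp only [F, Finsupp.linearCombination_apply, Finsupp.sum]
      induction c.support using Finset.induction_on with
      | empty => simpa using Lp.coeFn_zero ℝ p μ
      | insert n s hn ih =>
        rw [Finset.sum_insert hn, Finset.sum_insert hn]
        refine (Lp.coeFn_add _ _).trans (.add ?_ ih)
        filter_upwards [Lp.coeFn_smul (c n) ((hgp n).toLp), (hgp n).coeFn_toLp] with ω h1 h2
        rw [h1, Pi.smul_apply, h2, smul_eq_mul]
    have hlaw := hasLaw_sum_mul_gaussian hm hg hi c c.support
    rw [Lp.norm_def, eLpNorm_congr_ae hae, he, mul_comm]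
    have h3 := eLpNorm_map_measure (p := p) (f := ∑ n ∈ c.support, fun ω => c n * g n ω) (μ := μ)
      (g := (id : ℝ → ℝ)) aestronglyMeasurable_id hlaw.aemeasurable
    rw [Function.id_comp] at h3
    rw [← h3, hlaw.map_eq, eLpNorm_gaussianReal p (by positivity), ENNReal.toReal_mul,
      ENNReal.toReal_ofReal (by positivity)]
  have hdense : DenseRange e := fun c => by
    refine mem_closure_of_tendsto (lp.hasSum_single (by norm_num) c) (Eventually.of_forall ?_)
    intro s
    refine ⟨∑ n ∈ s, Finsupp.single n (c n), ?_⟩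
    simp only [map_sum, e, Finsupp.linearCombination_single]
    refine Finset.sum_congr rfl fun n _ => ?_
    rw [RealEllTwo.basisVec, ← lp.single_smul]
    simp
  have hb : ∀ c, ‖(γ⁻¹ • F) c‖ = ‖e c‖ := fun c => by
    rw [LinearMap.smul_apply, norm_smul, hF, Real.norm_of_nonneg (by positivity),
      inv_mul_cancel_left₀ hγ0.ne']
  have hle : ∃ C, ∀ c, ‖(γ⁻¹ • F) c‖ ≤ C * ‖e c‖ := ⟨1, fun c => by rw [hb, one_mul]⟩
  refine ⟨⟨((γ⁻¹ • F).extendOfNorm e).toLinearMap, fun c => ?_⟩⟩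
  refine hdense.induction_on (p := fun c => ‖(γ⁻¹ • F).extendOfNorm e c‖ = ‖c‖) c
    (isClosed_eq (by fun_prop) (by fun_prop)) fun c => ?_
  rw [LinearMap.extendOfNorm_eq hdense hle, hb]

end GaussianEmbedding

section HolderQuotient

variable {Ω : Type*} [MeasurableSpace Ω] {μ : Measure Ω} {p q : ℝ≥0∞} [Fact (1 ≤ p)] [Fact (1 ≤ q)]
  [ENNReal.HolderConjugate p q]

lemma abs_lpPairing_mul_le (f : Lp ℝ p μ) (u : Lp ℝ q μ) :
    |(ContinuousLinearMap.mul ℝ ℝ).lpPairing μ p q f u| ≤ ‖f‖ * ‖u‖ := by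
  have h1 := ContinuousLinearMap.norm_holder_apply_apply_le (r := 1) (ContinuousLinearMap.mul ℝ ℝ)
    f u
  have h2 := L1.norm_integral_le ((ContinuousLinearMap.mul ℝ ℝ).holder 1 f u)
  have h3 : ‖ContinuousLinearMap.mul ℝ ℝ‖ ≤ 1 := ContinuousLinearMap.opNorm_mul_le ℝ ℝ
  rw [← Real.norm_eq_abs, ContinuousLinearMap.lpPairing_eq_integral]
  rw [L1.integral_eq_integral, integral_congr_ae
    (ContinuousLinearMap.coeFn_holder (r := 1) (ContinuousLinearMap.mul ℝ ℝ) f u)] at h2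
  refine h2.trans (h1.trans ?_)
  rw [mul_assoc]
  exact mul_le_of_le_one_left (by positivity) h3

/-- Every unit vector of `L_q` is normed by a unit vector of the conjugate space `L_p`. -/
lemma exists_lpPairing_eq_one (hp : p ≠ ∞) (hq : q ≠ ∞) (u : Lp ℝ q μ) (hu : ‖u‖ = 1) :
    ∃ f : Lp ℝ p μ, ‖f‖ ≤ 1 ∧ (ContinuousLinearMap.mul ℝ ℝ).lpPairing μ p q f u = 1 := by
  have hpq : p.toReal.HolderConjugate q.toReal :=
    ENNReal.HolderConjugate.toReal_of_ne_top hp hq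
  have hu' : eLpNorm u q μ = 1 := by
    rw [Lp.norm_def] at hu
    rw [← ENNReal.toReal_eq_one_iff, hu]
  have hq1 : 0 < q.toReal - 1 := by linarith [hpq.symm.lt]
  have hpow : p * ENNReal.ofReal (q.toReal - 1) = q := by
    rw [← ENNReal.ofReal_toReal hp, ← ENNReal.ofReal_mul ENNReal.toReal_nonneg,
      ← ENNReal.ofReal_toReal hq, ENNReal.toReal_ofReal ENNReal.toReal_nonneg]
    congr 1
    have := hpq.mul_eq_add
    linarith
  set f : Ω → ℝ := fun x => u x * ‖u x‖ ^ (q.toReal - 2)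
  have hfm : AEStronglyMeasurable f μ := by
    have := (Lp.aestronglyMeasurable u).aemeasurable
    exact AEMeasurable.aestronglyMeasurable (by fun_prop)
  have hfn : eLpNorm f p μ = 1 := by
    have : eLpNorm f p μ = eLpNorm (fun x => ‖u x‖ ^ (q.toReal - 1)) p μ := by
      refine eLpNorm_congr_norm_ae (ae_of_all _ fun x => ?_)
      rcases eq_or_ne (u x) 0 with h | h
      · simp [f, h, hq1.ne']
      · rw [show q.toReal - 1 = (q.toReal - 2) + 1 by ring,
          Real.rpow_add_one (norm_ne_zero_iff.2 h)]
        simp only [f, norm_mul, norm_norm,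
          Real.norm_of_nonneg (Real.rpow_nonneg (norm_nonneg (u x)) _)]
        exact mul_comm _ _
    rw [this, eLpNorm_norm_rpow _ hq1, hpow, hu', ENNReal.one_rpow]
  have hf : MemLp f p μ := ⟨hfm, by rw [hfn]; exact ENNReal.one_lt_top⟩
  refine ⟨hf.toLp, by simp [hfn], ?_⟩
  have hint : ∫ x, ‖u x‖ ^ q.toReal ∂μ = 1 := by
    have h := (Lp.memLp u).eLpNorm_eq_integral_rpow_norm
      (zero_lt_one.trans_le (Fact.out : 1 ≤ q)).ne' hq
    have h0 : 0 ≤ ∫ x, ‖u x‖ ^ q.toReal ∂μ := integral_nonneg fun x => by positivity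
    rw [hu', eq_comm, ENNReal.ofReal_eq_one] at h
    rw [← Real.rpow_inv_rpow h0 hpq.symm.pos.ne', h, Real.one_rpow]
  rw [ContinuousLinearMap.lpPairing_eq_integral, ← hint]
  refine integral_congr_ae ?_
  filter_upwards [hf.coeFn_toLp] with x hx
  rw [hx, ContinuousLinearMap.mul_apply']
  rcases eq_or_ne (u x) 0 with h | h
  · simp [f, h, hpq.symm.pos.ne']
  · rw [show q.toReal = (q.toReal - 2) + 1 + 1 by ring, Real.rpow_add_one (norm_ne_zero_iff.2 h),
      Real.rpow_add_one (norm_ne_zero_iff.2 h)]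
    simp only [f, Real.norm_eq_abs]
    linear_combination (-(|u x| ^ (q.toReal - 2))) * abs_mul_abs_self (u x)

/-- The predual of an isometric embedding of `ℓ²` into `L_q` is a metric surjection of the conjugate
space `L_p` onto `ℓ²`. -/
lemma exists_metric_surjection (hp : p ≠ ∞) (hq : q ≠ ∞) (J : RealEllTwo →ₗᵢ[ℝ] Lp ℝ q μ) :
    ∃ Q : Lp ℝ p μ →L[ℝ] RealEllTwo, (∀ f, ‖Q f‖ ≤ ‖f‖) ∧
      ∀ h, ‖h‖ = 1 → ∃ f, ‖f‖ ≤ 1 ∧ Q f = h := by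
  set P := (ContinuousLinearMap.mul ℝ ℝ).lpPairing μ p q
  set Q₀ : Lp ℝ p μ → RealEllTwo := fun f =>
    (InnerProductSpace.toDual ℝ RealEllTwo).symm (P f ∘L J.toContinuousLinearMap)
  have hQ₀ : ∀ f h, inner ℝ (Q₀ f) h = P f (J h) := fun f h => by
    simp [Q₀]
  have hbound : ∀ f, ‖Q₀ f‖ ≤ 1 * ‖f‖ := fun f => by
    rw [one_mul, LinearIsometryEquiv.norm_map]
    refine ContinuousLinearMap.opNorm_le_bound _ (norm_nonneg _) fun h => ?_
    simpa using abs_lpPairing_mul_le f (J h)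
  set Q : Lp ℝ p μ →L[ℝ] RealEllTwo := LinearMap.mkContinuous
    { toFun := Q₀
      map_add' := fun f g => ext_inner_right ℝ fun h => by simp [inner_add_left, hQ₀]
      map_smul' := fun a f => ext_inner_right ℝ fun h => by simp [inner_smul_left, hQ₀] } 1 hbound
  have hQ : ∀ f, Q f = Q₀ f := fun f => rfl
  refine ⟨Q, fun f => by simpa [hQ] using hbound f, fun h hh => ?_⟩
  obtain ⟨f, hf, hfJ⟩ := exists_lpPairing_eq_one (p := p) hp hq (J h) (by simpa using hh)
  refine ⟨f, hf, ?_⟩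
  have h1 : inner ℝ (Q f) h = 1 := by rw [hQ, hQ₀, hfJ]
  have h2 : ‖Q f‖ ≤ 1 := (by simpa [hQ] using hbound f : ‖Q f‖ ≤ ‖f‖).trans hf
  have h3 := norm_sub_sq_real (Q f) h
  rw [h1, hh] at h3
  have h4 : ‖Q f - h‖ ^ 2 ≤ 0 := by nlinarith [norm_nonneg (Q f)]
  exact sub_eq_zero.1 (norm_eq_zero.1 (pow_eq_zero_iff two_ne_zero |>.1 (h4.antisymm (sq_nonneg _))))

end HolderQuotient

section SignSystem

variable {Ω : Type*} [MeasurableSpace Ω] {μ : Measure Ω} {g : ℕ → Ω → ℝ}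

/-- The signs of independent standard Gaussian variables form a Rademacher sequence, all of whose
nontrivial finite products have mean zero. -/
lemma exists_rademacher (hm : ∀ n, Measurable (g n))
    (hg : ∀ n, HasLaw (g n) (gaussianReal 0 1) μ) (hi : iIndepFun g μ) :
    ∃ ε : ℕ → Ω → ℝ, (∀ n, Measurable (ε n)) ∧ (∀ n x, ε n x = 1 ∨ ε n x = -1) ∧
      ∀ s : Finset ℕ, s.Nonempty → ∫ x, ∏ n ∈ s, ε n x ∂μ = 0 := by
  set σ : ℝ → ℝ := fun t => if 0 < t then 1 else -1
  have hσ : Measurable σ := Measurable.ite measurableSet_Ioi measurable_const measurable_const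
  have hmean : ∫ t, σ t ∂gaussianReal 0 1 = 0 := by
    have := nullSingletonClass_gaussianReal (μ := 0) (v := 1) one_ne_zero
    have h1 : ∫ t, σ t ∂gaussianReal 0 1 = ∫ t, σ (-t) ∂gaussianReal 0 1 := by
      rw [← integral_map (φ := fun t : ℝ => -t) (by fun_prop) hσ.aestronglyMeasurable,
        gaussianReal_map_neg, neg_zero]
    have h2 : ∫ t, σ (-t) ∂gaussianReal 0 1 = -∫ t, σ t ∂gaussianReal 0 1 := by
      rw [← integral_neg]
      refine integral_congr_ae ?_
      have h0 : ∀ᵐ t ∂gaussianReal 0 1, t ≠ 0 := by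
        rw [ae_iff]
        simp
      filter_upwards [h0] with t ht
      rcases lt_or_gt_of_ne ht with h | h <;> simp [σ, h, not_lt.2 h.le]
    linarith
  have hε : ∀ n, Measurable (σ ∘ g n) := fun n => hσ.comp (hm n)
  refine ⟨fun n => σ ∘ g n, hε, fun n x => ?_, fun s ⟨n, hn⟩ => ?_⟩
  · by_cases h : 0 < g n x <;> simp [σ, h]
  · have hind : iIndepFun (fun i : s => σ ∘ g i) μ :=
      (hi.comp (fun _ => σ) fun _ => hσ).precomp Subtype.val_injective
    have h := hind.integral_fun_prod_eq_prod_integral fun i => (hε i).aestronglyMeasurable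
    have h2 : ∀ x, ∏ i : s, (σ ∘ g i) x = ∏ i ∈ s, (σ ∘ g i) x := fun x =>
      Finset.prod_coe_sort s fun i => (σ ∘ g i) x
    simp only [h2] at h
    rw [h]
    refine Finset.prod_eq_zero (Finset.mem_univ ⟨n, hn⟩) ?_
    have := (hg n).integral_comp hσ.aestronglyMeasurable
    rw [this, hmean]

open RealEllTwo in
/-- An isometric embedding of `ℓ²` into `L_2` which maps the first unit vector and the others to
functions living on complementary sets of measure `1 / 2`, and which maps the pair vectors to
unimodular functions. -/
lemma exists_split_embedding [IsProbabilityMeasure μ] (hm : ∀ n, Measurable (g n))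
    (hg : ∀ n, HasLaw (g n) (gaussianReal 0 1) μ) (hi : iIndepFun g μ) :
    ∃ (W : RealEllTwo →ₗᵢ[ℝ] Lp ℝ 2 μ) (A B : Set Ω), MeasurableSet A ∧ MeasurableSet B ∧
      μ A = 2⁻¹ ∧ μ B = 2⁻¹ ∧ (∀ c, W (headOp c) =ᵐ[μ.restrict Aᶜ] 0) ∧
      (∀ c, W (weightOp c) =ᵐ[μ.restrict Bᶜ] 0) ∧ ∀ n, ∀ᵐ x ∂μ, |W (pairVec n) x| = 1 := by
  obtain ⟨ε, hεm, hε, hεi⟩ := exists_rademacher hm hg hi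
  have hprod : ∀ n, MemLp (ε n) ∞ μ := fun n =>
    memLp_top_of_bound (hεm n).aestronglyMeasurable 1 (ae_of_all _ fun x => by
      rcases hε n x with h | h <;> simp [h])
  set u : ℕ → Ω → ℝ := fun n x =>
    if n = 0 then (√2)⁻¹ * (1 + ε 0 x) else (√2)⁻¹ * ((1 - ε 0 x) * ε n x)
  have hs2 : (√2)⁻¹ * (√2)⁻¹ = (2 : ℝ)⁻¹ := by rw [← mul_inv, Real.mul_self_sqrt zero_le_two]
  have hu0 : ∀ x, u 0 x = (√2)⁻¹ * (1 + ε 0 x) := fun x => rfl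
  have hu1 : ∀ n x, n ≠ 0 → u n x = (√2)⁻¹ * ((1 - ε 0 x) * ε n x) := fun n x hn => if_neg hn
  have hum : ∀ n, Measurable (u n) := fun n => by
    by_cases hn : n = 0 <;> simp only [u, hn, if_true, if_false] <;> fun_prop
  have hsq : ∀ n x, ε n x * ε n x = 1 := fun n x => by rcases hε n x with h | h <;> simp [h]
  have hbd : ∀ n x, ‖ε n x‖ ≤ 1 := fun n x => by rcases hε n x with h | h <;> simp [h]
  have hmem : ∀ n, MemLp (u n) 2 μ := fun n => by
    refine MemLp.of_bound (hum n).aestronglyMeasurable 2 (ae_of_all _ fun x => ?_)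
    have h4 : (√2)⁻¹ ≤ 1 := inv_le_one_of_one_le₀ (Real.one_le_sqrt.2 one_le_two)
    have h5 : 0 ≤ (√2)⁻¹ := by positivity
    by_cases hn : n = 0
    · subst hn
      rw [hu0, Real.norm_eq_abs, abs_le]
      rcases hε 0 x with h | h <;> rw [h] <;> constructor <;> linarith
    · rw [hu1 n x hn, Real.norm_eq_abs, abs_le]
      rcases hε 0 x with h | h <;> rcases hε n x with h' | h' <;> rw [h, h'] <;> constructor <;>
        linarith
  have hint : ∀ s : Finset ℕ, Integrable (fun x => ∏ n ∈ s, ε n x) μ := fun s =>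
    .of_bound (Finset.measurable_prod _ fun i _ => hεm i).aestronglyMeasurable 1
      (ae_of_all _ fun x => by
        rw [norm_prod]
        exact Finset.prod_le_one (fun _ _ => norm_nonneg _) fun n _ => hbd n x)
  have h0 : ∫ x, ε 0 x ∂μ = 0 := by simpa using hεi {0} (by simp)
  have h0i : Integrable (ε 0) μ := by simpa using hint {0}
  have horth : Orthonormal ℝ fun n => (hmem n).toLp := by
    rw [orthonormal_iff_ite]
    intro n m
    have hinner : inner ℝ ((hmem n).toLp) ((hmem m).toLp) = ∫ x, u n x * u m x ∂μ := by
      rw [L2.inner_def]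
      refine integral_congr_ae ?_
      filter_upwards [(hmem n).coeFn_toLp, (hmem m).coeFn_toLp] with x h1 h2
      rw [h1, h2]
      simp [mul_comm]
    rw [hinner]
    have hdiag0 : ∀ x, u 0 x * u 0 x = 1 + ε 0 x := fun x => by
      rw [hu0]; linear_combination (1 + ε 0 x) ^ 2 * hs2 + 2⁻¹ * hsq 0 x
    have hdiag : ∀ n m x, n ≠ 0 → m ≠ 0 → u n x * u m x =
        ε n x * ε m x - ε 0 x * (ε n x * ε m x) := fun n m x hn hm => by
      rw [hu1 n x hn, hu1 m x hm]
      linear_combination ((1 - ε 0 x) ^ 2 * ε n x * ε m x) * hs2 +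
        2⁻¹ * (ε n x * ε m x) * hsq 0 x
    have hoff : ∀ n x, n ≠ 0 → u 0 x * u n x = 0 := fun n x hn => by
      rw [hu0, hu1 n x hn]
      linear_combination (-(√2)⁻¹ * (√2)⁻¹ * ε n x) * hsq 0 x
    by_cases hn : n = 0
    · subst hn
      by_cases hm : m = 0
      · subst hm
        simp only [hdiag0, if_true]
        rw [integral_add (integrable_const _) h0i, h0]
        simp
      · simp [hoff m _ hm, Ne.symm hm]
    · by_cases hm : m = 0
      · subst hm
        simp [mul_comm (u n _), hoff n _ hn, hn]
      · simp only [hdiag n m _ hn hm]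
        by_cases hnm : n = m
        · subst hnm
          simp only [hsq, mul_one, if_true]
          rw [integral_sub (integrable_const _) h0i, h0]
          simp
        · have e2 : ∀ x, ∏ k ∈ ({n, m} : Finset ℕ), ε k x = ε n x * ε m x := fun x =>
            Finset.prod_pair hnm
          have e3 : ∀ x, ∏ k ∈ ({0, n, m} : Finset ℕ), ε k x = ε 0 x * (ε n x * ε m x) :=
            fun x => by rw [Finset.prod_insert (by simp [Ne.symm hn, Ne.symm hm]), e2]
          have i2 := hint {n, m}
          have i3 := hint {0, n, m}
          have z2 := hεi {n, m} (by simp)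
          have z3 := hεi {0, n, m} (by simp)
          simp only [e2, e3] at i2 i3 z2 z3
          rw [integral_sub i2 i3, z2, z3]
          simp [hnm]
  set W := horth.orthogonalFamily.linearIsometry
  have hWb : ∀ n, W (basisVec n) = (hmem n).toLp := fun n => by
    simp [W, basisVec, OrthogonalFamily.linearIsometry_apply_single]
  have hWsum : ∀ c : RealEllTwo, HasSum (fun n => c n • (hmem n).toLp) (W c) := fun c => by
    simpa [W] using horth.orthogonalFamily.hasSum_linearIsometry c
  have hA : MeasurableSet {x | ε 0 x = 1} := measurableSet_eq_fun (hεm 0) measurable_const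
  have hB : MeasurableSet {x | ε 0 x = -1} := measurableSet_eq_fun (hεm 0) measurable_const
  have hhalf : ∀ S : Set Ω, μ.real S = 2⁻¹ → μ S = 2⁻¹ := fun S h => by
    rw [← ofReal_measureReal, h]
    simp [ENNReal.ofReal_inv_of_pos]
  have hμA : μ.real {x | ε 0 x = 1} = 2⁻¹ := by
    have : ∫ x, {x | ε 0 x = 1}.indicator 1 x ∂μ = ∫ x, 2⁻¹ * (1 + ε 0 x) ∂μ := by
      congr 1
      ext x
      rcases hε 0 x with h | h <;> simp [Set.indicator, h] <;> norm_num
    rw [integral_indicator_one hA, integral_const_mul,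
      integral_add (integrable_const _) h0i, h0] at this
    simpa using this
  have hμB : μ.real {x | ε 0 x = -1} = 2⁻¹ := by
    have : ∫ x, {x | ε 0 x = -1}.indicator 1 x ∂μ = ∫ x, 2⁻¹ * (1 - ε 0 x) ∂μ := by
      congr 1
      ext x
      rcases hε 0 x with h | h <;> simp [Set.indicator, h] <;> norm_num
    rw [integral_indicator_one hB, integral_const_mul,
      integral_sub (integrable_const _) h0i, h0] at this
    simpa using this
  refine ⟨W, {x | ε 0 x = 1}, {x | ε 0 x = -1}, hA, hB, hhalf _ hμA, hhalf _ hμB,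
    fun c => ?_, fun c => ?_, fun n => ?_⟩
  · rw [headOp_apply, map_smul, hWb]
    filter_upwards [ae_restrict_of_ae (Lp.coeFn_smul (c 0) ((hmem 0).toLp)),
      ae_restrict_of_ae (hmem 0).coeFn_toLp, ae_restrict_mem hA.compl] with x h1 h2 h3
    rw [h1, Pi.smul_apply, h2, hu0, (hε 0 x).resolve_left h3]
    simp
  · set R := LpToLpRestrictCLM Ω ℝ ℝ μ 2 {x | ε 0 x = -1}ᶜ
    have hR : ∀ n, weightOp c n • R ((hmem n).toLp) = 0 := fun n => by
      rcases eq_or_ne n 0 with rfl | hn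
      · simp [weightOp, diagonal_apply, weight]
      · rw [smul_eq_zero]
        right
        rw [Lp.eq_zero_iff_ae_eq_zero]
        filter_upwards [LpToLpRestrictCLM_coeFn ℝ {x | ε 0 x = -1}ᶜ ((hmem n).toLp),
          ae_restrict_of_ae (hmem n).coeFn_toLp, ae_restrict_mem hB.compl] with x h1 h2 h3
        rw [h1, h2, hu1 n x hn, (hε 0 x).resolve_right h3]
        simp
    have h := (hWsum (weightOp c)).mapL R
    simp only [map_smul, hR] at h
    have h' := (Lp.eq_zero_iff_ae_eq_zero).1 (h.unique hasSum_zero)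
    exact (LpToLpRestrictCLM_coeFn ℝ {x | ε 0 x = -1}ᶜ _).symm.trans h'
  · rw [pairVec, map_smul, map_add, hWb, hWb]
    filter_upwards [Lp.coeFn_smul (√2)⁻¹ ((hmem 0).toLp + (hmem (n + 1)).toLp),
      Lp.coeFn_add ((hmem 0).toLp) ((hmem (n + 1)).toLp), (hmem 0).coeFn_toLp,
      (hmem (n + 1)).coeFn_toLp] with x h1 h2 h3 h4
    rw [h1, Pi.smul_apply, h2, Pi.add_apply, h3, h4, hu0, hu1 _ _ n.succ_ne_zero, smul_eq_mul,
      ← mul_add, ← mul_assoc, hs2]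
    rcases hε 0 x with h | h <;> rcases hε (n + 1) x with h' | h' <;> rw [h, h'] <;> norm_num

end SignSystem

section HalfSupport

variable {Ω : Type*} [MeasurableSpace Ω] {μ : Measure Ω}

/-- On a probability space `L_s` is contractively included in `L_r` for `r ≤ s`. -/
lemma exists_Lp_inclusion (μ : Measure Ω) [IsProbabilityMeasure μ] {r s : ℝ≥0∞} [Fact (1 ≤ r)]
    [Fact (1 ≤ s)] (hrs : r ≤ s) :
    ∃ ι : Lp ℝ s μ →L[ℝ] Lp ℝ r μ, (∀ f, ‖ι f‖ ≤ ‖f‖) ∧ ∀ f, ι f =ᵐ[μ] f := by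
  have hmem : ∀ f : Lp ℝ s μ, MemLp f r μ := fun f => (Lp.memLp f).mono_exponent hrs
  have hbound : ∀ f : Lp ℝ s μ, ‖(hmem f).toLp‖ ≤ 1 * ‖f‖ := fun f => by
    rw [Lp.norm_toLp, one_mul, Lp.norm_def]
    exact ENNReal.toReal_mono (Lp.eLpNorm_ne_top f)
      (eLpNorm_le_eLpNorm_of_exponent_le hrs (Lp.aestronglyMeasurable f))
  refine ⟨LinearMap.mkContinuous
    { toFun := fun f => (hmem f).toLp
      map_add' := fun f g => ?_
      map_smul' := fun a f => ?_ } 1 hbound, fun f => by simpa using hbound f,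
    fun f => (hmem f).coeFn_toLp⟩
  · rw [← MemLp.toLp_add]
    exact MemLp.toLp_congr _ _ (Lp.coeFn_add f g)
  · rw [RingHom.id_apply, ← MemLp.toLp_const_smul]
    exact MemLp.toLp_congr _ _ (Lp.coeFn_smul a f)

/-- The norm of the inclusion of `L_s` into `L_r` on a set of probability one half. -/
noncomputable def halfContraction (r s : ℝ≥0∞) : ℝ := 2⁻¹ ^ (1 / r.toReal - 1 / s.toReal)

lemma halfContraction_nonneg (r s : ℝ≥0∞) : 0 ≤ halfContraction r s :=
  Real.rpow_nonneg (by norm_num) _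

lemma halfContraction_lt_one {r s : ℝ≥0∞} (hr : r ≠ 0) (hs : s ≠ ∞) (hrs : r < s) :
    halfContraction r s < 1 := by
  have hr' : 0 < r.toReal := ENNReal.toReal_pos hr hrs.ne_top
  have : r.toReal < s.toReal := (ENNReal.toReal_lt_toReal hrs.ne_top hs).2 hrs
  exact Real.rpow_lt_one (by norm_num) (by norm_num)
    (sub_pos.2 (one_div_lt_one_div_of_lt hr' this))

/-- Hölder's inequality on a set of measure one half. -/
lemma eLpNorm_indicator_toReal_le {r s : ℝ≥0∞} (hrs : r ≤ s) {S : Set Ω}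
    (hS : MeasurableSet S) (hμS : μ S = 2⁻¹) (f : Lp ℝ s μ) :
    (eLpNorm (S.indicator f) r μ).toReal ≤ halfContraction r s * ‖f‖ := by
  have h : eLpNorm (S.indicator f) r μ ≤
      eLpNorm f s μ * 2⁻¹ ^ (1 / r.toReal - 1 / s.toReal) := by
    rw [eLpNorm_indicator_eq_eLpNorm_restrict hS]
    refine (eLpNorm_le_eLpNorm_mul_rpow_measure_univ hrs
      (Lp.aestronglyMeasurable f).restrict).trans ?_
    rw [Measure.restrict_apply_univ, hμS]
    gcongr
    exact Measure.restrict_le_self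
  have htop : (2⁻¹ : ℝ≥0∞) ^ (1 / r.toReal - 1 / s.toReal) ≠ ∞ :=
    ENNReal.rpow_ne_top_of_ne_zero (by simp) (by simp)
  refine (ENNReal.toReal_mono (ENNReal.mul_ne_top (Lp.eLpNorm_ne_top f) htop) h).trans_eq ?_
  rw [ENNReal.toReal_mul, ← ENNReal.toReal_rpow, ← Lp.norm_def, mul_comm, halfContraction]
  simp

lemma ae_eq_indicator_of_ae_restrict_compl {S : Set Ω} (hS : MeasurableSet S) {f : Ω → ℝ}
    (hf : f =ᵐ[μ.restrict Sᶜ] 0) : f =ᵐ[μ] S.indicator f := by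
  filter_upwards [(ae_restrict_iff' hS.compl).1 hf] with x hx
  by_cases h : x ∈ S
  · simp [h]
  · simpa [h] using hx h

lemma norm_inclusion_le {r s : ℝ≥0∞} (hrs : r ≤ s) {S : Set Ω}
    (hS : MeasurableSet S) (hμS : μ S = 2⁻¹) {f : Lp ℝ s μ} {g : Lp ℝ r μ} (hg : g =ᵐ[μ] f)
    (hf : f =ᵐ[μ.restrict Sᶜ] 0) : ‖g‖ ≤ halfContraction r s * ‖f‖ := by
  rw [Lp.norm_def, eLpNorm_congr_ae (hg.trans (ae_eq_indicator_of_ae_restrict_compl hS hf))]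
  exact eLpNorm_indicator_toReal_le hrs hS hμS f

lemma abs_inner_inclusion_le [IsProbabilityMeasure μ] {s : ℝ≥0∞} (hs : 2 ≤ s) {S : Set Ω}
    (hS : MeasurableSet S) (hμS : μ S = 2⁻¹) {f : Lp ℝ s μ} {g u : Lp ℝ 2 μ} (hg : g =ᵐ[μ] f)
    (hu : u =ᵐ[μ.restrict Sᶜ] 0) : |inner ℝ u g| ≤ ‖u‖ * (halfContraction 2 s * ‖f‖) := by
  have hmem : MemLp (S.indicator f) 2 μ := ((Lp.memLp f).mono_exponent hs).indicator hS
  have hinner : inner ℝ u g = inner ℝ u hmem.toLp := by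
    rw [L2.inner_def, L2.inner_def]
    refine integral_congr_ae ?_
    filter_upwards [hg, hmem.coeFn_toLp, (ae_restrict_iff' hS.compl).1 hu] with x hgx hx hux
    rw [hgx, hx]
    by_cases h : x ∈ S
    · simp [h]
    · simp [hux h]
  rw [hinner]
  refine (abs_real_inner_le_norm _ _).trans ?_
  gcongr
  rw [Lp.norm_toLp]
  exact eLpNorm_indicator_toReal_le hs hS hμS f

lemma eLpNorm_eq_one_of_ae_abs_eq_one [IsProbabilityMeasure μ] {r : ℝ≥0∞} (hr : r ≠ 0) {f : Ω → ℝ}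
    (hf : ∀ᵐ x ∂μ, |f x| = 1) : eLpNorm f r μ = 1 := by
  rw [eLpNorm_congr_norm_ae (g := fun _ => (1 : ℝ)) (by simpa using hf),
    eLpNorm_const _ hr (IsProbabilityMeasure.ne_zero μ)]
  simp

end HalfSupport

section Cases

open RealEllTwo

variable {Ω : Type*} [MeasurableSpace Ω] {μ : Measure Ω} [IsProbabilityMeasure μ] {g : ℕ → Ω → ℝ}

/-- The embedding of `ℓ²` into `L₂` is used through its adjoint, before the Gaussian embedding. -/
lemma not_CPP_of_two_lt {p q : ℝ≥0∞} [Fact (1 ≤ p)] [Fact (1 ≤ q)] (hm : ∀ n, Measurable (g n))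
    (hg : ∀ n, HasLaw (g n) (gaussianReal 0 1) μ) (hi : iIndepFun g μ)
    (hp : p ≠ ∞) (hq : q ≠ ∞) (h2p : 2 < p) : ¬ CPP (Lp ℝ p μ) (Lp ℝ q μ) := by
  obtain ⟨W, S₀, S₁, hS₀, hS₁, hμ₀, hμ₁, hW₀, hW₁, hpair⟩ := exists_split_embedding hm hg hi
  obtain ⟨J⟩ := exists_linearIsometry_Lp hm hg hi q hq
  obtain ⟨ι, hι, hιf⟩ := exists_Lp_inclusion μ h2p.le
  set V := W.toContinuousLinearMap
  have hV : ∀ u, ‖V.adjoint u‖ ≤ ‖u‖ := fun u => by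
    have h : ‖V.adjoint‖ ≤ 1 := by
      rw [LinearIsometryEquiv.norm_map]
      exact W.norm_toContinuousLinearMap_le
    simpa using V.adjoint.le_of_opNorm_le h u
  have hshrink : ∀ (D : RealEllTwo →L[ℝ] RealEllTwo) (S : Set Ω), MeasurableSet S → μ S = 2⁻¹ →
      (∀ c, ‖D c‖ ≤ ‖c‖) → (∀ c d, inner ℝ c (D d) = inner ℝ (D c) d) →
      (∀ c, W (D c) =ᵐ[μ.restrict Sᶜ] 0) →
      ∀ f, ‖J (D (V.adjoint (ι f)))‖ ≤ halfContraction 2 p * ‖f‖ := by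
    intro D S hS hμS hD hsymm hWD f
    rw [J.norm_map]
    set z := D (V.adjoint (ι f)) with hz
    have h1 : ‖z‖ * ‖z‖ ≤ ‖z‖ * (halfContraction 2 p * ‖f‖) := by
      have h2 : inner ℝ z z = inner ℝ (W (D z)) (ι f) := by
        conv_lhs => rw [hz, hsymm, ContinuousLinearMap.adjoint_inner_right]
        rfl
      rw [← real_inner_self_eq_norm_mul_norm, h2]
      refine (le_abs_self _).trans
        ((abs_inner_inclusion_le h2p.le hS hμS (hιf f) (hWD z)).trans ?_)
      rw [W.norm_map]
      have := halfContraction_nonneg 2 p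
      gcongr
      exact hD z
    rcases (norm_nonneg z).eq_or_lt with h0 | h0
    · rw [← h0]
      exact mul_nonneg (halfContraction_nonneg 2 p) (norm_nonneg f)
    · exact le_of_mul_le_mul_left h1 h0
  refine not_CPP_of_factorization (V.adjoint ∘L ι) J.toContinuousLinearMap
    (fun f => (hV _).trans (hι f)) (fun c => (J.norm_map c).le) (halfContraction_nonneg 2 p)
    (halfContraction_lt_one two_ne_zero hp h2p)
    (hshrink weightOp S₁ hS₁ hμ₁ norm_weightOp_apply_le inner_weightOp_right hW₁)
    (hshrink headOp S₀ hS₀ hμ₀ norm_headOp_apply_le inner_headOp_right hW₀) (fun n => ?_)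
    (fun n => by simp [norm_pairVec])
  have hnorm : eLpNorm (W (pairVec n)) p μ = 1 :=
    eLpNorm_eq_one_of_ae_abs_eq_one (zero_lt_two.trans h2p).ne' (hpair n)
  have hmem : MemLp (W (pairVec n)) p μ :=
    ⟨Lp.aestronglyMeasurable _, hnorm ▸ ENNReal.one_lt_top⟩
  refine ⟨hmem.toLp, by simp [hnorm], ?_⟩
  have hιW : ι hmem.toLp = W (pairVec n) := Lp.ext ((hιf _).trans hmem.coeFn_toLp)
  rw [ContinuousLinearMap.comp_apply, hιW]
  refine ext_inner_right ℝ fun c => ?_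
  rw [ContinuousLinearMap.adjoint_inner_left]
  exact W.inner_map_map _ _

/-- The quotient map onto `ℓ²` is followed by the embedding of `ℓ²` into `L₂`, included in `L_q`. -/
lemma not_CPP_of_lt_two {p q : ℝ≥0∞} [Fact (1 ≤ p)] [Fact (1 ≤ q)] (hm : ∀ n, Measurable (g n))
    (hg : ∀ n, HasLaw (g n) (gaussianReal 0 1) μ) (hi : iIndepFun g μ)
    (hp1 : 1 < p) (hp : p ≠ ∞) (hq2 : q < 2) : ¬ CPP (Lp ℝ p μ) (Lp ℝ q μ) := by
  obtain ⟨W, S₀, S₁, hS₀, hS₁, hμ₀, hμ₁, hW₀, hW₁, hpair⟩ := exists_split_embedding hm hg hi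
  obtain ⟨ι, hι, hιf⟩ := exists_Lp_inclusion μ hq2.le
  have hpc : ENNReal.HolderConjugate p p.conjExponent :=
    ENNReal.HolderConjugate.conjExponent hp1.le
  have : Fact (1 ≤ p.conjExponent) := ⟨hpc.symm.one_le⟩
  have hpc' : p.conjExponent ≠ ∞ := by
    rw [ENNReal.conjExponent]
    simp [tsub_eq_zero_iff_le, hp1]
  obtain ⟨J⟩ := exists_linearIsometry_Lp hm hg hi p.conjExponent hpc'
  obtain ⟨Q, hQ, hQsurj⟩ := exists_metric_surjection (p := p) hp hpc' J
  have hq0 : q ≠ 0 := (zero_lt_one.trans_le (Fact.out : 1 ≤ q)).ne'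
  have hshrink : ∀ (D : RealEllTwo →L[ℝ] RealEllTwo) (S : Set Ω), MeasurableSet S → μ S = 2⁻¹ →
      (∀ c, ‖D c‖ ≤ ‖c‖) → (∀ c, W (D c) =ᵐ[μ.restrict Sᶜ] 0) →
      ∀ f, ‖ι (W (D (Q f)))‖ ≤ halfContraction q 2 * ‖f‖ := by
    intro D S hS hμS hD hWD f
    refine (norm_inclusion_le hq2.le hS hμS (hιf _) (hWD _)).trans ?_
    rw [W.norm_map]
    exact mul_le_mul_of_nonneg_left ((hD _).trans (hQ f)) (halfContraction_nonneg q 2)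
  refine not_CPP_of_factorization Q (ι ∘L W.toContinuousLinearMap) hQ
    (fun c => (hι _).trans_eq (W.norm_map c)) (halfContraction_nonneg q 2)
    (halfContraction_lt_one hq0 ENNReal.ofNat_ne_top hq2)
    (hshrink weightOp S₁ hS₁ hμ₁ norm_weightOp_apply_le hW₁)
    (hshrink headOp S₀ hS₀ hμ₀ norm_headOp_apply_le hW₀)
    (fun n => hQsurj _ (norm_pairVec n)) (fun n => ?_)
  change ‖ι (W (pairVec n))‖ = 1
  rw [Lp.norm_def, eLpNorm_congr_ae (hιf _), eLpNorm_eq_one_of_ae_abs_eq_one hq0 (hpair n),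
    ENNReal.toReal_one]

end Cases

theorem Lp_Lq_fails_CPP (p q : ℝ≥0∞) [Fact (1 ≤ p)] [Fact (1 ≤ q)]
    (hp : 1 < p) (hp' : p ≠ ∞) (hq' : q ≠ ∞) (hpq : 2 < p ∨ q < 2) :
    ¬ CPP (Lp ℝ p (volume.restrict (Set.Icc (0:ℝ) 1)))
          (Lp ℝ q (volume.restrict (Set.Icc (0:ℝ) 1))) := by
  obtain ⟨g, hm, hg, hi⟩ := exists_iid_gaussian_Icc
  have : IsProbabilityMeasure (volume.restrict (Set.Icc (0 : ℝ) 1)) := ⟨by simp⟩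
  rcases hpq with h | h
  · exact not_CPP_of_two_lt hm hg hi hp' hq' h
  · exact not_CPP_of_lt_two hm hg hi hp hp' h
end

section
/- Let (E_n)_{n∈ℕ} and (F_n)_{n∈ℕ} be sequences of finite-dimensional real normed spaces, let 1 < p < ∞ and 1 ≤ q < ∞ be real numbers, and let X be a closed linear subspace of the ℓ_p-sum (⊕_n E_n)_p and Y a closed linear subspace of the ℓ_q-sum (⊕_n F_n)_q. Then the pair (X, Y) has the weak maximizing property. -/
open Filter Topology
open scoped ENNReal

/-- A sequence converges weakly to `0` if `f (x n) → 0` for every continuous linear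
functional `f`. -/
def WeaklyNull {X : Type*} [NormedAddCommGroup X] [NormedSpace ℝ X] (x : ℕ → X) : Prop :=
  ∀ f : X →L[ℝ] ℝ, Tendsto (fun n => f (x n)) atTop (nhds 0)

/-- The pair `(X, Y)` has the weak maximizing property: every operator admitting a
non-weakly-null maximizing sequence in the unit sphere attains its norm. -/
def WMP (X Y : Type*) [NormedAddCommGroup X] [NormedSpace ℝ X]
    [NormedAddCommGroup Y] [NormedSpace ℝ Y] : Prop :=
  ∀ T : X →L[ℝ] Y,
    (∃ x : ℕ → X, (∀ n, ‖x n‖ = 1) ∧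
      Tendsto (fun n => ‖T (x n)‖) atTop (nhds ‖T‖) ∧ ¬ WeaklyNull x) →
    NormAttains T

/-- If vectors can be added one at a time so that `‖·‖ ^ r` grows by at most `C` while `ψ` grows by
at least `c > 0`, then `ψ` cannot be bounded by `D * ‖·‖ ^ s` with `s < r`. -/
theorem not_forall_exists_rpow_norm_add_le {V : Type*} [NormedAddCommGroup V]
    {r s C c D : ℝ} (hr : 0 < r) (hs : 0 < s) (hsr : s < r) (hC : 0 ≤ C) (hc : 0 < c) (hD : 0 ≤ D)
    {ψ : V → ℝ} (hψ0 : 0 ≤ ψ 0) (hψ : ∀ u, ψ u ≤ D * ‖u‖ ^ s) :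
    ¬ ∀ u, ∃ z, ‖u + z‖ ^ r ≤ ‖u‖ ^ r + C ∧ ψ u + c ≤ ψ (u + z) := by
  intro h
  have key : ∀ K : ℕ, ∃ u, ‖u‖ ^ r ≤ K * C ∧ K * c ≤ ψ u := by
    intro K
    induction K with
    | zero => exact ⟨0, by simp [Real.zero_rpow hr.ne'], by simpa using hψ0⟩
    | succ K ih =>
      obtain ⟨u, hu, hu'⟩ := ih
      obtain ⟨z, hz, hz'⟩ := h u
      refine ⟨u + z, ?_, ?_⟩ <;> push_cast <;> linarith
  have hbound : ∀ K : ℕ, 0 < K → (K : ℝ) ^ (1 - s / r) ≤ D * C ^ (s / r) / c := by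
    intro K hK
    obtain ⟨u, hu, hu'⟩ := key K
    have hK' : (0 : ℝ) < K := by exact_mod_cast hK
    have h1 : ‖u‖ ^ s ≤ (K * C) ^ (s / r) := by
      calc ‖u‖ ^ s = (‖u‖ ^ r) ^ (s / r) := by
            rw [← Real.rpow_mul (norm_nonneg _), mul_div_cancel₀ _ hr.ne']
        _ ≤ _ := Real.rpow_le_rpow (by positivity) hu (by positivity)
    rw [Real.mul_rpow hK'.le hC] at h1
    rw [Real.rpow_sub hK', Real.rpow_one, div_le_div_iff₀ (by positivity) hc]
    calc K * c ≤ D * ‖u‖ ^ s := hu'.trans (hψ u)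
      _ ≤ D * ((K : ℝ) ^ (s / r) * C ^ (s / r)) := by gcongr
      _ = _ := by ring
  have hexp : 0 < 1 - s / r := by
    rw [sub_pos, div_lt_one hr]
    exact hsr
  have hlim : Tendsto (fun K : ℕ => (K : ℝ) ^ (1 - s / r)) atTop atTop :=
    (tendsto_rpow_atTop hexp).comp tendsto_natCast_atTop_atTop
  obtain ⟨K, hK, hK0⟩ :=
    ((hlim.eventually_gt_atTop (D * C ^ (s / r) / c)).and (eventually_gt_atTop 0)).exists
  exact absurd (hbound K hK0) (not_le.mpr hK)

/-- In finite dimension, a sequence on which all functionals tend to `0` is norm null. -/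
theorem tendsto_zero_of_weaklyNull {V : Type*} [NormedAddCommGroup V] [NormedSpace ℝ V]
    [FiniteDimensional ℝ V] {v : ℕ → V} (hv : WeaklyNull v) : Tendsto v atTop (𝓝 0) := by
  let b := Module.finBasis ℝ V
  have h : Tendsto (fun n => ∑ i, b.coord i (v n) • b i) atTop (𝓝 (∑ i, (0 : ℝ) • b i)) :=
    tendsto_finsetSum _ fun i _ => (hv (b.coord i).toContinuousLinearMap).smul_const _
  simpa [b.sum_repr] using h

section LpSum

variable {E : ℕ → Type*} [∀ n, NormedAddCommGroup (E n)] {p : ℝ≥0∞}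

theorem tendsto_rpow_norm_add_sum_single (hp0 : 0 < p.toReal)
    {z : ℕ → lp E p} (hz : ∀ k, Tendsto (fun n => z n k) atTop (𝓝 0)) (u : ∀ k, E k)
    (s : Finset ℕ) :
    Tendsto (fun n => ‖∑ k ∈ s, lp.single p k (u k) + z n‖ ^ p.toReal - ‖z n‖ ^ p.toReal) atTop
      (𝓝 (‖∑ k ∈ s, lp.single p k (u k)‖ ^ p.toReal)) := by
  have hv : ∀ k ∈ s, (∑ k ∈ s, lp.single p k (u k) : lp E p) k = u k := by
    intro k hk
    simp only [lp.coeFn_sum, lp.coeFn_single, Finset.sum_apply, Finset.sum_pi_single, if_pos hk]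
  have heq : ∀ n, ‖∑ k ∈ s, lp.single p k (u k) + z n‖ ^ p.toReal - ‖z n‖ ^ p.toReal =
      ∑ k ∈ s, (‖u k + z n k‖ ^ p.toReal - ‖z n k‖ ^ p.toReal) := by
    intro n
    have h1 := lp.norm_sub_norm_compl_sub_single hp0 (∑ k ∈ s, lp.single p k (u k) + z n) s
    have h2 := lp.norm_sub_norm_compl_sub_single hp0 (z n) s
    have h3 : ∑ k ∈ s, lp.single p k ((∑ k ∈ s, lp.single p k (u k) + z n : lp E p) k) =
        ∑ k ∈ s, lp.single p k (u k) + ∑ k ∈ s, lp.single p k (z n k) := by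
      rw [← Finset.sum_add_distrib]
      refine Finset.sum_congr rfl fun k hk => ?_
      rw [lp.coeFn_add, Pi.add_apply, hv k hk, lp.single_add]
    rw [h3, add_sub_add_left_eq_sub] at h1
    rw [Finset.sum_sub_distrib, ← h2]
    have h4 : ∑ k ∈ s, ‖(∑ k ∈ s, lp.single p k (u k) + z n : lp E p) k‖ ^ p.toReal =
        ∑ k ∈ s, ‖u k + z n k‖ ^ p.toReal := by
      refine Finset.sum_congr rfl fun k hk => ?_
      rw [lp.coeFn_add, Pi.add_apply, hv k hk]
    linarith
  simp_rw [heq]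
  rw [lp.norm_sum_single hp0]
  refine tendsto_finsetSum _ fun k _ => ?_
  have h1 := ((tendsto_const_nhds (x := u k)).add (hz k)).norm.rpow_const (.inr hp0.le)
  have h2 := (hz k).norm.rpow_const (.inr hp0.le)
  simpa [Real.zero_rpow hp0.ne'] using h1.sub h2

variable [Fact (1 ≤ p)]

/-- A Brezis–Lieb type splitting of the norm of an `ℓ_p`-sum along bounded coordinatewise null
sequences. -/
theorem tendsto_rpow_norm_add (hp : p ≠ ∞)
    {z : ℕ → lp E p} {B : ℝ} (hB : ∀ n, ‖z n‖ ≤ B)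
    (hz : ∀ k, Tendsto (fun n => z n k) atTop (𝓝 0)) (u : lp E p) :
    Tendsto (fun n => ‖u + z n‖ ^ p.toReal - ‖z n‖ ^ p.toReal) atTop (𝓝 (‖u‖ ^ p.toReal)) := by
  have hp0 : 0 < p.toReal := ENNReal.toReal_pos (zero_lt_one.trans_le Fact.out).ne' hp
  have hB0 : 0 ≤ B := (norm_nonneg _).trans (hB 0)
  rw [Metric.tendsto_atTop]
  intro ε hε
  have huc := isCompact_Icc.uniformContinuousOn_of_continuous
    ((Real.continuous_rpow_const hp0.le).continuousOn (s := Set.Icc 0 (‖u‖ + 1 + B)))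
  obtain ⟨δ, hδ, hδ'⟩ := Metric.uniformContinuousOn_iff.mp huc (ε / 3) (by positivity)
  obtain ⟨s, hs⟩ := (Metric.tendsto_nhds.mp (lp.hasSum_single hp u) (min δ 1)
    (by positivity)).exists
  set v : lp E p := ∑ k ∈ s, lp.single p k (u k)
  rw [dist_eq_norm, lt_min_iff] at hs
  obtain ⟨N, hN⟩ := Metric.tendsto_atTop.mp (tendsto_rpow_norm_add_sum_single hp0 hz u s) (ε / 3)
    (by positivity)
  have hv : ‖v‖ ≤ ‖u‖ + 1 := by
    linarith [norm_sub_norm_le v u]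
  have hclose : ∀ w : lp E p, ‖w‖ ≤ B → |‖v + w‖ ^ p.toReal - ‖u + w‖ ^ p.toReal| < ε / 3 := by
    intro w hw
    refine hδ' _ ⟨norm_nonneg _, ?_⟩ _ ⟨norm_nonneg _, ?_⟩ ?_
    · linarith [norm_add_le v w]
    · linarith [norm_add_le u w]
    · rw [Real.dist_eq]
      refine (abs_norm_sub_norm_le _ _).trans_lt ?_
      rw [add_sub_add_right_eq_sub]
      exact hs.1
  refine ⟨N, fun n hn => ?_⟩
  have h1 := hclose (z n) (hB n)
  have h2 := hclose 0 (by simpa using hB0)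
  have h3 := hN n hn
  rw [add_zero, add_zero] at h2
  rw [Real.dist_eq] at h3 ⊢
  rw [abs_lt] at h1 h2 h3 ⊢
  constructor <;> linarith

/-- A bounded sequence in an `ℓ_p`-sum of proper spaces has a subsequence converging
coordinatewise to an element of the sum. -/
theorem exists_subseq_tendsto_apply [∀ n, ProperSpace (E n)] {x : ℕ → lp E p} {B : ℝ}
    (hB : ∀ n, ‖x n‖ ≤ B) :
    ∃ (a : lp E p) (φ : ℕ → ℕ), StrictMono φ ∧
      ∀ k, Tendsto (fun n => x (φ n) k) atTop (𝓝 (a k)) := by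
  have hcpt : IsCompact (Set.univ.pi fun k : ℕ => Metric.closedBall (0 : E k) B) :=
    isCompact_univ_pi fun k => isCompact_closedBall _ _
  obtain ⟨a, -, φ, hφ, ha⟩ := hcpt.tendsto_subseq (x := fun n k => x n k) fun n k _ => by
    rw [mem_closedBall_zero_iff]
    exact (lp.norm_apply_le_norm (zero_lt_one.trans_le Fact.out).ne' _ _).trans (hB n)
  have hbdd : Bornology.IsBounded (Set.range fun n => x (φ n)) :=
    isBounded_iff_forall_norm_le.mpr ⟨B, Set.forall_mem_range.mpr fun n => hB _⟩
  exact ⟨⟨a, lp.memℓp_of_tendsto hbdd ha⟩, φ, hφ, fun k => tendsto_pi_nhds.mp ha k⟩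

variable [∀ n, NormedSpace ℝ (E n)]

/-- For `1 < p < ∞`, bounded coordinatewise null sequences in an `ℓ_p`-sum are weakly null. -/
theorem weaklyNull_of_tendsto_apply (hp1 : 1 < p) (hp : p ≠ ∞)
    {z : ℕ → lp E p} {B : ℝ} (hB : ∀ n, ‖z n‖ ≤ B)
    (hz : ∀ k, Tendsto (fun n => z n k) atTop (𝓝 0)) : WeaklyNull z := by
  have hB0 : 0 ≤ B := (norm_nonneg _).trans (hB 0)
  have hp1' : 1 < p.toReal := by
    simpa using (ENNReal.toReal_lt_toReal ENNReal.one_ne_top hp).mpr hp1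
  have hp0 : 0 < p.toReal := zero_lt_one.trans hp1'
  have key : ∀ g : lp E p →L[ℝ] ℝ, ∀ ε > 0, ∀ᶠ n in atTop, g (z n) < ε := by
    intro g ε hε
    by_contra hcon
    refine not_forall_exists_rpow_norm_add_le (r := p.toReal) (s := 1) (C := B ^ p.toReal + 1)
      (D := ‖g‖) (ψ := g) hp0 one_pos hp1' (by positivity) hε (norm_nonneg _) (by simp)
      (fun u => ?_) fun u => ?_
    · rw [Real.rpow_one]
      exact (le_abs_self _).trans (g.le_opNorm u)
    · obtain ⟨n, hn, hn'⟩ := ((not_eventually.mp hcon).and_eventually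
        ((tendsto_rpow_norm_add hp hB hz u).eventually_lt_const (lt_add_one _))).exists
      have := Real.rpow_le_rpow (norm_nonneg _) (hB n) hp0.le
      refine ⟨z n, by linarith, ?_⟩
      rw [map_add]
      linarith
  intro g
  rw [Metric.tendsto_nhds]
  intro ε hε
  filter_upwards [key g ε hε, key (-g) ε hε] with n h1 h2
  rw [neg_apply] at h2
  rw [Real.dist_eq, sub_zero, abs_lt]
  constructor <;> linarith

/-- A closed subspace of an `ℓ_p`-sum, `1 < p < ∞`, contains the coordinatewise limits of its
bounded sequences. -/
theorem Submodule.mem_of_tendsto_apply (hp1 : 1 < p) (hp : p ≠ ∞) {X : Submodule ℝ (lp E p)}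
    (hX : IsClosed (X : Set (lp E p))) {x : ℕ → X} {B : ℝ} (hB : ∀ n, ‖x n‖ ≤ B) {a : lp E p}
    (ha : ∀ k, Tendsto (fun n => (x n : lp E p) k) atTop (𝓝 (a k))) : a ∈ X := by
  by_contra hmem
  obtain ⟨g, c, hg, hga⟩ := geometric_hahn_banach_closed_point X.convex hX hmem
  have hnull : WeaklyNull fun n => (x n : lp E p) - a := by
    refine weaklyNull_of_tendsto_apply hp1 hp (B := B + ‖a‖) (fun n => ?_) fun k => ?_
    · exact (norm_sub_le _ _).trans (add_le_add_left (hB n) _)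
    · simpa using (ha k).sub_const (a k)
  have hlim : Tendsto (fun n => g (x n)) atTop (𝓝 (g a)) := by
    simpa using (hnull g).add_const (g a)
  exact absurd (le_of_tendsto hlim (.of_forall fun n => (hg _ (x n).2).le)) (not_le.mpr hga)

/-- Bounded coordinatewise null sequences in a subspace of an `ℓ_p`-sum are weakly null. -/
theorem weaklyNull_of_tendsto_apply_submodule (hp1 : 1 < p) (hp : p ≠ ∞)
    {X : Submodule ℝ (lp E p)} {z : ℕ → X} {B : ℝ} (hB : ∀ n, ‖z n‖ ≤ B)
    (hz : ∀ k, Tendsto (fun n => (z n : lp E p) k) atTop (𝓝 0)) : WeaklyNull z := by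
  intro f
  obtain ⟨g, hg, -⟩ := exists_extension_norm_eq X f
  simpa [hg] using weaklyNull_of_tendsto_apply hp1 hp hB hz g

/-- Bounded operators map weakly null sequences to coordinatewise null sequences. -/
theorem WeaklyNull.tendsto_apply [∀ n, FiniteDimensional ℝ (E n)] {V : Type*}
    [NormedAddCommGroup V] [NormedSpace ℝ V] {z : ℕ → V} (hz : WeaklyNull z)
    (S : V →L[ℝ] lp E p) (k : ℕ) : Tendsto (fun n => S (z n) k) atTop (𝓝 0) :=
  tendsto_zero_of_weaklyNull fun f => hz (f.comp ((lp.evalCLM ℝ E p k).comp S))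

end LpSum

section Operators

variable {E F : ℕ → Type*} [∀ n, NormedAddCommGroup (E n)] [∀ n, NormedSpace ℝ (E n)]
  [∀ n, NormedAddCommGroup (F n)] [∀ n, NormedSpace ℝ (F n)]
  {p q : ℝ≥0∞} [Fact (1 ≤ p)] [Fact (1 ≤ q)] {X : Submodule ℝ (lp E p)}

/-- A Pitt type theorem: for `q < p < ∞`, operators from a subspace of an `ℓ_p`-sum to an `ℓ_q`-sum
send bounded coordinatewise null sequences with coordinatewise null image to norm null sequences. -/
theorem tendsto_zero_of_lt (hqp : q < p) (hp : p ≠ ∞) (S : X →L[ℝ] lp F q) {z : ℕ → X} {B : ℝ}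
    (hB : ∀ n, ‖z n‖ ≤ B) (hz : ∀ k, Tendsto (fun n => (z n : lp E p) k) atTop (𝓝 0))
    (hSz : ∀ k, Tendsto (fun n => S (z n) k) atTop (𝓝 0)) :
    Tendsto (fun n => S (z n)) atTop (𝓝 0) := by
  have hq : q ≠ ∞ := hqp.ne_top
  have hB0 : 0 ≤ B := (norm_nonneg _).trans (hB 0)
  have hp0 : 0 < p.toReal := ENNReal.toReal_pos (zero_lt_one.trans_le Fact.out).ne' hp
  have hq0 : 0 < q.toReal := ENNReal.toReal_pos (zero_lt_one.trans_le Fact.out).ne' hq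
  rw [tendsto_zero_iff_norm_tendsto_zero, Metric.tendsto_nhds]
  intro ε hε
  by_contra hcon
  refine not_forall_exists_rpow_norm_add_le (V := X) (r := p.toReal) (s := q.toReal)
    (C := B ^ p.toReal + 1) (c := ε ^ q.toReal / 2) (D := ‖S‖ ^ q.toReal)
    (ψ := fun u => ‖S u‖ ^ q.toReal) hp0 hq0 ((ENNReal.toReal_lt_toReal hq hp).mpr hqp)
    (by positivity) (by positivity) (by positivity) (by positivity) (fun u => ?_) fun u => ?_
  · rw [← Real.mul_rpow (norm_nonneg S) (norm_nonneg u)]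
    exact Real.rpow_le_rpow (norm_nonneg _) (S.le_opNorm u) hq0.le
  · have hlow := (tendsto_rpow_norm_add hq
      (fun n => S.le_opNorm_of_le (hB n)) hSz (S u)).eventually_const_lt
        (sub_lt_self _ (show 0 < ε ^ q.toReal / 2 by positivity))
    have hupp := (tendsto_rpow_norm_add hp (z := fun n => (z n : lp E p)) hB hz u).eventually_lt_const (lt_add_one _)
    obtain ⟨n, hn, h1, h2⟩ := ((not_eventually.mp hcon).and_eventually (hlow.and hupp)).exists
    simp only [Real.dist_eq, sub_zero, abs_norm, not_lt] at hn
    have h3 := Real.rpow_le_rpow hε.le hn hq0.le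
    have h4 := Real.rpow_le_rpow (norm_nonneg _) (hB n) hp0.le
    refine ⟨z n, ?_, ?_⟩
    · simp only [Submodule.coe_norm, Submodule.coe_add] at h4 ⊢
      linarith
    · simp only [map_add]
      linarith

/-- If a maximizing sequence of unit vectors `x n` splits as `a + z n` with `z n` and its image
coordinatewise null, then `a` almost realizes the norm of the operator. -/
theorem opNorm_mul_norm_le (hp : p ≠ ∞) (hq : q ≠ ∞) (S : X →L[ℝ] lp F q) {x : ℕ → X} {a : X}
    (hx : ∀ n, ‖x n‖ = 1) (hS : Tendsto (fun n => ‖S (x n)‖) atTop (𝓝 ‖S‖))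
    (hz : ∀ k, Tendsto (fun n => ((x n - a : X) : lp E p) k) atTop (𝓝 0))
    (hSz : ∀ k, Tendsto (fun n => S (x n - a) k) atTop (𝓝 0)) :
    ‖a‖ ≤ 1 ∧ ‖S‖ * ‖a‖ ≤ ‖S a‖ := by
  have hp0 : 0 < p.toReal := ENNReal.toReal_pos (zero_lt_one.trans_le Fact.out).ne' hp
  have hq0 : 0 < q.toReal := ENNReal.toReal_pos (zero_lt_one.trans_le Fact.out).ne' hq
  have hB : ∀ n, ‖x n - a‖ ≤ 1 + ‖a‖ := fun n => by simpa [hx n] using norm_sub_le (x n) a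
  have hdom : Tendsto (fun n => ‖x n - a‖ ^ p.toReal) atTop (𝓝 (1 - ‖a‖ ^ p.toReal)) := by
    have h := (tendsto_rpow_norm_add hp (z := fun n => ((x n - a : X) : lp E p)) hB hz a).const_sub 1
    refine h.congr fun n => ?_
    have h1 : ‖(a : lp E p) + ((x n - a : X) : lp E p)‖ = 1 := by
      rw [← Submodule.coe_add, add_sub_cancel, ← hx n, Submodule.coe_norm]
    rw [h1, Real.one_rpow, sub_sub_cancel, Submodule.coe_norm]
  have hpos : 0 ≤ 1 - ‖a‖ ^ p.toReal := ge_of_tendsto' hdom fun n => by positivity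
  have ha : ‖a‖ ≤ 1 := by
    rw [← Real.rpow_le_rpow_iff (norm_nonneg _) zero_le_one hp0, Real.one_rpow]
    linarith
  refine ⟨ha, ?_⟩
  rcases lt_or_ge q p with hqp | hpq
  · have hlim : Tendsto (fun n => ‖S (x n)‖) atTop (𝓝 ‖S a‖) := by
      have h := ((tendsto_zero_of_lt hqp hp S hB hz hSz).add_const (S a)).norm
      simpa using h
    rw [tendsto_nhds_unique hS hlim]
    exact mul_le_of_le_one_right (norm_nonneg _) ha
  · have hpq' : p.toReal ≤ q.toReal := ENNReal.toReal_mono hq hpq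
    have hcod : Tendsto (fun n => ‖S (x n - a)‖ ^ q.toReal) atTop
        (𝓝 (‖S‖ ^ q.toReal - ‖S a‖ ^ q.toReal)) := by
      have h := (hS.rpow_const (.inr hq0.le)).sub
        (tendsto_rpow_norm_add hq (fun n => S.le_opNorm_of_le (hB n)) hSz (S a))
      refine h.congr fun n => ?_
      rw [← map_add, add_sub_cancel, sub_sub_cancel]
    have hdom' := (hdom.rpow_const (p := q.toReal / p.toReal) (.inr (by positivity))).const_mul
      (‖S‖ ^ q.toReal)
    have hle := le_of_tendsto_of_tendsto' hcod hdom' fun n => by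
      rw [← Real.rpow_mul (norm_nonneg _), mul_div_cancel₀ _ hp0.ne',
        ← Real.mul_rpow (norm_nonneg S) (norm_nonneg (x n - a))]
      exact Real.rpow_le_rpow (norm_nonneg _) (S.le_opNorm _) hq0.le
    have hpow : (1 - ‖a‖ ^ p.toReal) ^ (q.toReal / p.toReal) ≤ 1 - ‖a‖ ^ p.toReal :=
      Real.rpow_le_self_of_le_one hpos (by linarith [Real.rpow_nonneg (norm_nonneg a) p.toReal])
        ((one_le_div hp0).mpr hpq')
    have hapow : ‖a‖ ^ q.toReal ≤ ‖a‖ ^ p.toReal :=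
      Real.rpow_le_rpow_of_exponent_ge_of_imp (norm_nonneg _) ha hpq' fun _ h =>
        absurd h hq0.ne'
    rw [← Real.rpow_le_rpow_iff (by positivity) (norm_nonneg _) hq0,
      Real.mul_rpow (norm_nonneg S) (norm_nonneg a)]
    have h1 := mul_le_mul_of_nonneg_left (hpow.trans (sub_le_sub_left hapow 1))
      (show 0 ≤ ‖S‖ ^ q.toReal by positivity)
    linarith

end Operators

theorem subspaces_of_lp_sums_have_WMP
    (E F : ℕ → Type*)
    [∀ n, NormedAddCommGroup (E n)] [∀ n, NormedSpace ℝ (E n)]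
    [∀ n, FiniteDimensional ℝ (E n)]
    [∀ n, NormedAddCommGroup (F n)] [∀ n, NormedSpace ℝ (F n)]
    [∀ n, FiniteDimensional ℝ (F n)]
    (p q : ℝ≥0∞) [Fact (1 ≤ p)] [Fact (1 ≤ q)]
    (hp : 1 < p) (hp' : p ≠ ∞) (hq' : q ≠ ∞)
    (X : Submodule ℝ (lp E p)) (hX : IsClosed (X : Set (lp E p)))
    (Y : Submodule ℝ (lp F q)) (hY : IsClosed (Y : Set (lp F q))) :
    WMP X Y := by
  rintro T ⟨x, hx, hT, hnull⟩
  have : ∀ n, ProperSpace (E n) := fun n => FiniteDimensional.proper_real (E n)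
  simp only [WeaklyNull, not_forall] at hnull
  obtain ⟨f, hf⟩ := hnull
  simp only [Metric.tendsto_nhds, not_forall, not_eventually, Real.dist_eq, sub_zero, not_lt] at hf
  obtain ⟨ε, hε, hf⟩ := hf
  obtain ⟨φ, hφ, hfφ⟩ := extraction_of_frequently_atTop hf
  obtain ⟨a, θ, hθ, ha⟩ := exists_subseq_tendsto_apply (x := fun n => (x (φ n) : lp E p))
    fun n => (hx (φ n)).le
  set y : ℕ → X := fun n => x (φ (θ n))
  have hy : ∀ n, ‖y n‖ = 1 := fun n => hx _
  have haX : a ∈ X := Submodule.mem_of_tendsto_apply hp hp' hX (x := y) (fun n => (hy n).le) ha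
  lift a to X using haX
  have hz : ∀ k, Tendsto (fun n => ((y n - a : X) : lp E p) k) atTop (𝓝 0) := fun k => by
    simpa using (ha k).sub_const ((a : lp E p) k)
  have hweak : WeaklyNull fun n => y n - a :=
    weaklyNull_of_tendsto_apply_submodule hp hp' (B := 1 + ‖a‖)
      (fun n => by simpa [hy n] using norm_sub_le (y n) a) hz
  have ha0 : a ≠ 0 := by
    rintro rfl
    have h := hweak f
    simp only [sub_zero] at h
    have h' := ge_of_tendsto' h.abs fun n => hfφ (θ n)
    rw [abs_zero] at h'
    exact absurd h' (not_le.mpr hε)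
  have hS : ‖Y.subtypeₗᵢ.toContinuousLinearMap.comp T‖ = ‖T‖ :=
    Y.subtypeₗᵢ.norm_toContinuousLinearMap_comp
  obtain ⟨-, hle⟩ := opNorm_mul_norm_le hp' hq' (Y.subtypeₗᵢ.toContinuousLinearMap.comp T) hy
    (by rw [hS]; exact hT.comp (hφ.comp hθ).tendsto_atTop) hz (hweak.tendsto_apply _)
  rw [hS] at hle
  change ‖T‖ * ‖a‖ ≤ ‖T a‖ at hle
  have hapos : 0 < ‖a‖ := norm_pos_iff.mpr ha0
  refine ⟨‖a‖⁻¹ • a, (norm_smul_inv_norm (𝕜 := ℝ) ha0).le, ?_⟩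
  rw [map_smul, norm_smul, norm_inv, norm_norm, (T.le_opNorm a).antisymm hle,
    mul_comm, mul_inv_cancel_right₀ hapos.ne']
end

section
/- Let (E_n)_{n∈ℕ} be a sequence of finite-dimensional real normed spaces, let 1 < p < ∞ be a real number, and let Z = (⊕_n E_n)_p be the ℓ_p-sum. If (w_n) is a sequence in Z converging weakly to 0 and v ∈ Z, then ‖w_n + v‖ − (‖w_n‖^p + ‖v‖^p)^{1/p} → 0 as n → ∞. -/
open Filter Topology
open scoped ENNReal

open WithLp in
/-- `‖a + b‖ - ‖(a, b)‖_p` is Lipschitz in `(a, b)`. -/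
theorem abs_norm_add_sub_norm_toLp_sub_le {X : Type*} [NormedAddCommGroup X]
    (p : ℝ≥0∞) [Fact (1 ≤ p)] (a b a' b' : X) :
    |(‖a + b‖ - ‖toLp p (a, b)‖) - (‖a' + b'‖ - ‖toLp p (a', b')‖)| ≤
      2 * (‖a - a'‖ + ‖b - b'‖) := by
  have h₁ : |‖a + b‖ - ‖a' + b'‖| ≤ ‖a - a'‖ + ‖b - b'‖ := by
    refine (abs_norm_sub_norm_le _ _).trans ?_
    rw [add_sub_add_comm]
    exact norm_add_le _ _
  have h₂ : |‖toLp p (a, b)‖ - ‖toLp p (a', b')‖| ≤ ‖a - a'‖ + ‖b - b'‖ := by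
    refine (abs_norm_sub_norm_le _ _).trans ?_
    have : toLp p (a, b) - toLp p (a', b') =
        toLp p (a - a', (0 : X)) + toLp p ((0 : X), b - b') := by
      rw [← toLp_sub, ← toLp_add]
      simp
    rw [this]
    refine (norm_add_le _ _).trans_eq ?_
    rw [norm_toLp_fst, norm_toLp_snd]
  rw [abs_le] at *
  constructor <;> linarith [h₁.1, h₁.2, h₂.1, h₂.2]

/-- A weakly null sequence in a finite-dimensional normed space is norm null. -/
theorem tendsto_zero_of_forall_dual_tendsto_zero {ι F : Type*} [NormedAddCommGroup F]
    [NormedSpace ℝ F] [FiniteDimensional ℝ F] {l : Filter ι} {x : ι → F}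
    (hx : ∀ f : F →L[ℝ] ℝ, Tendsto (fun n => f (x n)) l (𝓝 0)) : Tendsto x l (𝓝 0) := by
  let e := (Module.finBasis ℝ F).equivFunL
  have h : Tendsto (fun n => e (x n)) l (𝓝 0) :=
    tendsto_pi_nhds.2 fun i =>
      hx ((ContinuousLinearMap.proj (R := ℝ) (φ := fun _ => ℝ) i).comp e.toContinuousLinearMap)
  simpa [Function.comp_def] using (e.symm.continuous.tendsto 0).comp h

namespace lp

variable {ι : Type*} {E : ι → Type*} [∀ i, NormedAddCommGroup (E i)] {p : ℝ≥0∞}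

theorem norm_add_eq_norm_toLp_of_disjoint (hp : 0 < p.toReal) {f g : lp E p}
    (h : ∀ i, f i = 0 ∨ g i = 0) : ‖f + g‖ = ‖WithLp.toLp p (f, g)‖ := by
  have hsum : ‖f + g‖ ^ p.toReal = ‖f‖ ^ p.toReal + ‖g‖ ^ p.toReal := by
    refine (hasSum_norm hp (f + g)).unique ?_
    convert (hasSum_norm hp f).add (hasSum_norm hp g) using 2 with i
    rcases h i with h | h <;> simp [h, Real.zero_rpow hp.ne']
  rw [WithLp.prod_norm_eq_add hp, WithLp.toLp_fst, WithLp.toLp_snd, ← hsum, one_div,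
    Real.rpow_rpow_inv (norm_nonneg' _) hp.ne']

theorem sum_single_apply [DecidableEq ι] (f : ∀ i, E i) (s : Finset ι) (i : ι) :
    (∑ j ∈ s, lp.single p j (f j) : lp E p) i = if i ∈ s then f i else 0 := by
  simp only [coeFn_sum, lp.coeFn_single, Finset.sum_apply, Finset.sum_pi_single]

end lp

theorem lp_sum_weakly_null_norm_formula
    (E : ℕ → Type*)
    [∀ n, NormedAddCommGroup (E n)] [∀ n, NormedSpace ℝ (E n)]
    [∀ n, FiniteDimensional ℝ (E n)]
    (p : ℝ≥0∞) [Fact (1 ≤ p)] (hp : 1 < p) (hp' : p ≠ ∞)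
    (w : ℕ → lp E p)
    (hw : ∀ f : (lp E p) →L[ℝ] ℝ, Tendsto (fun n => f (w n)) atTop (nhds 0))
    (v : lp E p) :
    Tendsto (fun n =>
        ‖w n + v‖ - (‖w n‖ ^ p.toReal + ‖v‖ ^ p.toReal) ^ (1 / p.toReal))
      atTop (nhds 0) := by
  have hp₀ : 0 < p.toReal := ENNReal.toReal_pos (zero_lt_one.trans hp).ne' hp'
  have hcoord (i : ℕ) : Tendsto (fun n => ‖w n i‖) atTop (𝓝 0) := by
    have : Tendsto (fun n => w n i) atTop (𝓝 0) :=
      tendsto_zero_of_forall_dual_tendsto_zero fun f => hw (f.comp (lp.evalCLM ℝ E p i))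
    simpa using this.norm
  rw [Metric.tendsto_nhds]
  intro ε hε
  obtain ⟨s, hs⟩ : ∃ s : Finset ℕ, ‖∑ i ∈ s, lp.single p i (v i) - v‖ < ε / 4 := by
    have := (Metric.tendsto_nhds.1 (lp.hasSum_single hp' v) (ε / 4) (by positivity)).exists
    simpa only [dist_eq_norm] using this
  have hsum : Tendsto (fun n => ∑ i ∈ s, ‖w n i‖) atTop (𝓝 0) := by
    simpa using tendsto_finsetSum s fun i _ => hcoord i
  filter_upwards [hsum.eventually_lt_const (show 0 < ε / 4 by positivity)] with n hn
  set P : lp E p := ∑ i ∈ s, lp.single p i (w n i) with hP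
  have hPn : ‖P‖ ≤ ∑ i ∈ s, ‖w n i‖ := by
    refine (norm_sum_le _ _).trans_eq ?_
    simp only [lp.norm_single (zero_lt_one.trans hp)]
  have hdisj := lp.norm_add_eq_norm_toLp_of_disjoint hp₀
    (f := w n - P) (g := ∑ i ∈ s, lp.single p i (v i)) fun i => by
      rw [lp.coeFn_sub, Pi.sub_apply, hP, lp.sum_single_apply, lp.sum_single_apply]
      by_cases hi : i ∈ s <;> simp [hi]
  have hlip := abs_norm_add_sub_norm_toLp_sub_le p (w n) v (w n - P)
    (∑ i ∈ s, lp.single p i (v i))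
  rw [hdisj, sub_self, sub_zero, sub_sub_cancel, norm_sub_rev v,
    WithLp.prod_norm_eq_add hp₀] at hlip
  rw [Real.dist_eq, sub_zero]
  refine hlip.trans_lt ?_
  linarith
end

section
/- Let (E_n)_{n∈ℕ} and (F_n)_{n∈ℕ} be sequences of finite-dimensional real normed spaces, let p, q be real numbers with 1 ≤ q < p < ∞, and let X be a closed linear subspace of the ℓ_p-sum (⊕_n E_n)_p and Y a closed linear subspace of the ℓ_q-sum (⊕_n F_n)_q. Then every bounded linear operator from X to Y is compact. -/
open Filter Topology
open scoped ENNReal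

namespace lp

variable {ι : Type*} {E : ι → Type*} [∀ i, NormedAddCommGroup (E i)] {p : ℝ≥0∞}

lemma norm_add_rpow_sub_norm_rpow (hp : 0 < p.toReal) {s : Finset ι} {z : lp E p}
    (hz : ∀ i ∉ s, z i = 0) (u : lp E p) :
    ‖z + u‖ ^ p.toReal - ‖u‖ ^ p.toReal =
      ∑ i ∈ s, (‖z i + u i‖ ^ p.toReal - ‖u i‖ ^ p.toReal) := by
  refine ((lp.hasSum_norm hp (z + u)).sub (lp.hasSum_norm hp u)).unique ?_
  exact hasSum_sum_of_ne_finset_zero fun i hi ↦ by simp [hz i hi]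

/-- If a bounded sequence in an `ℓ^p`-sum tends to zero coordinatewise, then its members are
asymptotically disjoint from any fixed vector. -/
lemma tendsto_norm_add_rpow_sub_norm_rpow [Fact (1 ≤ p)] (hp : p ≠ ∞) (z : lp E p)
    {u : ℕ → lp E p} {M : ℝ} (hM : ∀ k, ‖u k‖ ≤ M)
    (hu : ∀ i, Tendsto (fun k ↦ u k i) atTop (𝓝 0)) :
    Tendsto (fun k ↦ ‖z + u k‖ ^ p.toReal - ‖u k‖ ^ p.toReal) atTop (𝓝 (‖z‖ ^ p.toReal)) := by
  classical
  have hr : 0 < p.toReal := ENNReal.toReal_pos (zero_lt_one.trans_le Fact.out).ne' hp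
  have hz : Tendsto (fun s : Finset ι ↦ ∑ i ∈ s, lp.single p i (z i)) atTop (𝓝 z) :=
    lp.hasSum_single hp z
  have hsupp (s : Finset ι) (i : ι) (hi : i ∉ s) :
      (∑ j ∈ s, lp.single p j (z j) : lp E p) i = 0 := by
    rw [lp.coeFn_sum, Finset.sum_apply]
    exact Finset.sum_eq_zero fun j hj ↦
      lp.single_apply_ne p j _ (ne_of_mem_of_not_mem hj hi).symm
  have hfin (s : Finset ι) : Tendsto
      (fun k ↦ ‖∑ i ∈ s, lp.single p i (z i) + u k‖ ^ p.toReal - ‖u k‖ ^ p.toReal) atTop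
      (𝓝 (‖∑ i ∈ s, lp.single p i (z i)‖ ^ p.toReal)) := by
    have h0 := norm_add_rpow_sub_norm_rpow hr (hsupp s) 0
    simp only [add_zero, norm_zero, Real.zero_rpow hr.ne', sub_zero] at h0
    simp only [norm_add_rpow_sub_norm_rpow hr (hsupp s), h0]
    refine tendsto_finsetSum _ fun i _ ↦ ?_
    have h1 := ((hu i).const_add ((∑ j ∈ s, lp.single p j (z j) : lp E p) i)).norm.rpow_const
      (p := p.toReal) (Or.inr hr.le)
    have h2 := (hu i).norm.rpow_const (p := p.toReal) (Or.inr hr.le)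
    simpa [hr.ne'] using h1.sub h2
  refine TendstoUniformlyOnFilter.tendsto_of_eventually_tendsto (p := atTop) ?_
    (Eventually.of_forall hfin) (hz.norm.rpow_const (Or.inr hr.le))
  refine TendstoUniformly.tendstoUniformlyOnFilter ?_ |>.mono_right le_top
  rw [Metric.tendstoUniformly_iff]
  intro ε hε
  have huc : UniformContinuousOn (fun t : ℝ ↦ t ^ p.toReal) (Set.Icc 0 (‖z‖ + 1 + M)) :=
    isCompact_Icc.uniformContinuousOn_of_continuous
      (Real.continuous_rpow_const hr.le).continuousOn
  obtain ⟨δ, hδ, hδε⟩ := Metric.uniformContinuousOn_iff.1 huc ε hε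
  filter_upwards [Metric.tendsto_nhds.1 hz (min δ 1) (by positivity)] with s hs k
  rw [lt_min_iff, dist_eq_norm] at hs
  set w : lp E p := ∑ i ∈ s, lp.single p i (z i)
  rw [dist_sub_right]
  have hw : ‖w‖ ≤ ‖z‖ + 1 := by
    have := norm_sub_norm_le w z
    linarith [hs.2]
  refine hδε _ ⟨norm_nonneg _, ?_⟩ _ ⟨norm_nonneg _, ?_⟩ ?_
  · linarith [norm_add_le z (u k), hM k]
  · linarith [norm_add_le w (u k), hM k]
  · refine (dist_norm_norm_le _ _).trans_lt ?_
    rw [add_sub_add_right_eq_sub, norm_sub_rev]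
    exact hs.1

/-- A bounded sequence in an `ℓ^p`-sum of countably many finite-dimensional spaces has a
coordinatewise convergent subsequence. -/
lemma exists_subseq_tendsto_apply {E : ℕ → Type*} [∀ n, NormedAddCommGroup (E n)]
    [∀ n, ProperSpace (E n)] (hp : p ≠ 0) {x : ℕ → lp E p} {M : ℝ}
    (hM : ∀ k, ‖x k‖ ≤ M) :
    ∃ a : ∀ n, E n, ∃ φ : ℕ → ℕ, StrictMono φ ∧
      ∀ n, Tendsto (fun k ↦ x (φ k) n) atTop (𝓝 (a n)) := by
  have hK : IsCompact (Set.univ.pi fun n ↦ Metric.closedBall (0 : E n) M) :=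
    isCompact_univ_pi fun n ↦ isCompact_closedBall 0 M
  obtain ⟨a, -, φ, hφ, ha⟩ := hK.tendsto_subseq (x := fun k n ↦ x k n) fun k n _ ↦ by
    simpa using (lp.norm_apply_le_norm hp (x k) n).trans (hM k)
  exact ⟨a, φ, hφ, fun n ↦ tendsto_pi_nhds.1 ha n⟩

end lp

lemma not_forall_natCast_mul_le_rpow {b c r : ℝ} (hb : 0 < b) (hr : r < 1) :
    ¬ ∀ n : ℕ, n * b ≤ c * (n : ℝ) ^ r := by
  intro h
  have ht : Tendsto (fun n : ℕ ↦ c * (n : ℝ) ^ (-(1 - r))) atTop (𝓝 (c * 0)) :=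
    ((tendsto_rpow_neg_atTop (sub_pos.2 hr)).comp tendsto_natCast_atTop_atTop).const_mul c
  rw [mul_zero] at ht
  obtain ⟨n, hn, hn0⟩ := ((ht.eventually_lt_const hb).and (eventually_gt_atTop 0)).exists
  have hn0' : (0 : ℝ) < n := by exact_mod_cast hn0
  have := h n
  rw [neg_sub, Real.rpow_sub_one hn0'.ne', ← mul_div_assoc, div_lt_iff₀ hn0'] at hn
  linarith

/-- A bounded linear operator from a subspace of an `ℓ^p`-sum into an `ℓ^q`-sum, `q < p`, maps
bounded sequences `u` such that both `u` and its image tend to zero coordinatewise to sequences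
which are not bounded away from zero. -/
lemma exists_norm_lt_of_tendsto_apply {ι κ : Type*} {E : ι → Type*} {F : κ → Type*}
    [∀ i, NormedAddCommGroup (E i)] [∀ i, NormedSpace ℝ (E i)]
    [∀ j, NormedAddCommGroup (F j)] [∀ j, NormedSpace ℝ (F j)]
    {p q : ℝ≥0∞} [Fact (1 ≤ p)] [Fact (1 ≤ q)] (hqp : q < p) (hp : p ≠ ∞)
    {X : Submodule ℝ (lp E p)} (T : X →L[ℝ] lp F q) {u : ℕ → X} {M : ℝ} (hM : ∀ k, ‖u k‖ ≤ M)
    (hu : ∀ i, Tendsto (fun k ↦ (u k : lp E p) i) atTop (𝓝 0))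
    (hTu : ∀ j, Tendsto (fun k ↦ T (u k) j) atTop (𝓝 0)) {ε : ℝ} (hε : 0 < ε) :
    ∃ k, ‖T (u k)‖ < ε := by
  by_contra! hlow
  have hq : q ≠ ∞ := hqp.ne_top
  have hr : 0 < p.toReal := ENNReal.toReal_pos (zero_lt_one.trans_le Fact.out).ne' hp
  have hs : 0 < q.toReal := ENNReal.toReal_pos (zero_lt_one.trans_le Fact.out).ne' hq
  have hsr : q.toReal < p.toReal := (ENNReal.toReal_lt_toReal hq hp).2 hqp
  have hM0 : 0 ≤ M := (norm_nonneg _).trans (hM 0)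
  have key (n : ℕ) : ∃ x : X, ‖x‖ ^ p.toReal ≤ n * (M ^ p.toReal + 1) ∧
      n * (ε ^ q.toReal / 2) ≤ ‖T x‖ ^ q.toReal := by
    induction n with
    | zero => exact ⟨0, by simp [hr.ne', hs.ne']⟩
    | succ n ih =>
      obtain ⟨x, hx, hTx⟩ := ih
      have h1 := lp.tendsto_norm_add_rpow_sub_norm_rpow hp (x : lp E p) (u := fun k ↦ u k) hM hu
      have h2 := lp.tendsto_norm_add_rpow_sub_norm_rpow hq (T x)
        (fun k ↦ T.le_opNorm_of_le (hM k)) hTu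
      obtain ⟨k, hk1, hk2⟩ := ((h1.eventually_lt_const (lt_add_one _)).and
        (h2.eventually_const_lt (sub_lt_self _ (half_pos (Real.rpow_pos_of_pos hε q.toReal))))).exists
      have hku : ‖u k‖ ^ p.toReal ≤ M ^ p.toReal :=
        Real.rpow_le_rpow (norm_nonneg _) (hM k) hr.le
      have hkT : ε ^ q.toReal ≤ ‖T (u k)‖ ^ q.toReal := Real.rpow_le_rpow hε.le (hlow k) hs.le
      refine ⟨x + u k, ?_, ?_⟩
      · change ‖x + u k‖ ^ p.toReal - ‖u k‖ ^ p.toReal < ‖x‖ ^ p.toReal + 1 at hk1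
        push_cast
        linarith
      · rw [map_add]
        push_cast
        linarith
  refine not_forall_natCast_mul_le_rpow (b := ε ^ q.toReal / 2)
    (c := ‖T‖ ^ q.toReal * (M ^ p.toReal + 1) ^ (q.toReal / p.toReal))
    (half_pos (Real.rpow_pos_of_pos hε _)) ((div_lt_one hr).2 hsr) fun n ↦ ?_
  obtain ⟨x, hx, hTx⟩ := key n
  have hA : 0 ≤ M ^ p.toReal + 1 := by positivity
  calc n * (ε ^ q.toReal / 2) ≤ ‖T x‖ ^ q.toReal := hTx
    _ ≤ (‖T‖ * ‖x‖) ^ q.toReal := Real.rpow_le_rpow (norm_nonneg _) (T.le_opNorm x) hs.le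
    _ = ‖T‖ ^ q.toReal * (‖x‖ ^ p.toReal) ^ (q.toReal / p.toReal) := by
      rw [Real.mul_rpow T.opNorm_nonneg (norm_nonneg x), ← Real.rpow_mul (norm_nonneg x),
        mul_div_cancel₀ _ hr.ne']
    _ ≤ ‖T‖ ^ q.toReal * (n * (M ^ p.toReal + 1)) ^ (q.toReal / p.toReal) := by gcongr
    _ = _ := by rw [Real.mul_rpow n.cast_nonneg hA]; ring

/-- A bounded linear operator from a subspace of an `ℓ^p`-sum into an `ℓ^q`-sum of
finite-dimensional spaces, `q < p`, maps bounded sequences to sequences with a Cauchy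
subsequence. -/
lemma exists_subseq_cauchySeq_map {E F : ℕ → Type*}
    [∀ n, NormedAddCommGroup (E n)] [∀ n, NormedSpace ℝ (E n)] [∀ n, ProperSpace (E n)]
    [∀ n, NormedAddCommGroup (F n)] [∀ n, NormedSpace ℝ (F n)] [∀ n, ProperSpace (F n)]
    {p q : ℝ≥0∞} [Fact (1 ≤ p)] [Fact (1 ≤ q)] (hqp : q < p) (hp : p ≠ ∞)
    {X : Submodule ℝ (lp E p)} (T : X →L[ℝ] lp F q) {x : ℕ → X} {M : ℝ} (hM : ∀ k, ‖x k‖ ≤ M) :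
    ∃ φ : ℕ → ℕ, StrictMono φ ∧ CauchySeq fun k ↦ T (x (φ k)) := by
  have hp0 : p ≠ 0 := (zero_lt_one.trans_le Fact.out).ne'
  have hq0 : q ≠ 0 := (zero_lt_one.trans_le Fact.out).ne'
  obtain ⟨a, φ, hφ, ha⟩ := lp.exists_subseq_tendsto_apply hp0 (x := fun k ↦ (x k : lp E p)) hM
  obtain ⟨b, ψ, hψ, hb⟩ := lp.exists_subseq_tendsto_apply hq0 (x := fun k ↦ T (x (φ k)))
    fun k ↦ T.le_opNorm_of_le (hM (φ k))
  refine ⟨φ ∘ ψ, hφ.comp hψ, Metric.cauchySeq_iff'.2 fun ε hε ↦ ?_⟩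
  by_contra! hfar
  choose m hm hfar using hfar
  have hm' : Tendsto m atTop atTop := tendsto_atTop_mono hm tendsto_id
  obtain ⟨k, hk⟩ := exists_norm_lt_of_tendsto_apply hqp hp T
    (u := fun k ↦ x (φ (ψ (m k))) - x (φ (ψ k))) (M := M + M)
    (fun k ↦ (norm_sub_le _ _).trans (add_le_add (hM _) (hM _)))
    (fun i ↦ by
      have h := (ha i).comp hψ.tendsto_atTop
      simpa using (h.comp hm').sub h)
    (fun j ↦ by simpa using ((hb j).comp hm').sub (hb j)) hε
  rw [map_sub, ← dist_eq_norm] at hk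
  exact (hfar k).not_gt hk

theorem operators_between_lp_sums_compact
    (E F : ℕ → Type*)
    [∀ n, NormedAddCommGroup (E n)] [∀ n, NormedSpace ℝ (E n)]
    [∀ n, FiniteDimensional ℝ (E n)]
    [∀ n, NormedAddCommGroup (F n)] [∀ n, NormedSpace ℝ (F n)]
    [∀ n, FiniteDimensional ℝ (F n)]
    (p q : ℝ≥0∞) [Fact (1 ≤ p)] [Fact (1 ≤ q)]
    (hqp : q < p) (hp' : p ≠ ∞)
    (X : Submodule ℝ (lp E p)) (hX : IsClosed (X : Set (lp E p)))
    (Y : Submodule ℝ (lp F q)) (hY : IsClosed (Y : Set (lp F q)))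
    (T : X →L[ℝ] Y) :
    IsCompactOperator ⇑T := by
  have (n : ℕ) : ProperSpace (E n) := FiniteDimensional.proper_real (E n)
  have (n : ℕ) : ProperSpace (F n) := FiniteDimensional.proper_real (F n)
  have : CompleteSpace Y := hY.completeSpace_coe
  refine (isCompactOperator_iff_isCompact_closure_image_closedBall (T : X →ₗ[ℝ] Y)
    zero_lt_one).2 (IsSeqCompact.isCompact fun y hy ↦ ?_)
  have happrox (k : ℕ) : ∃ x : X, ‖x‖ ≤ 1 ∧ dist (y k) (T x) < 1 / ((k : ℝ) + 1) := by
    obtain ⟨_, ⟨x, hx, rfl⟩, hxy⟩ := Metric.mem_closure_iff.1 (hy k) _ Nat.one_div_pos_of_nat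
    exact ⟨x, by simpa using hx, hxy⟩
  choose x hx hxy using happrox
  obtain ⟨φ, hφ, hc⟩ := exists_subseq_cauchySeq_map hqp hp' (Y.subtypeL ∘L T) hx
  have hc' : CauchySeq fun k ↦ T (x (φ k)) := by
    rw [Metric.cauchySeq_iff] at hc ⊢
    exact hc
  obtain ⟨l, hl⟩ := cauchySeq_tendsto_of_complete hc'
  have hyl : Tendsto (y ∘ φ) atTop (𝓝 l) := by
    refine hl.congr_dist ?_
    refine squeeze_zero (fun _ ↦ dist_nonneg) (fun k ↦ ?_)
      (tendsto_one_div_add_atTop_nhds_zero_nat.comp hφ.tendsto_atTop)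
    rw [dist_comm]
    exact (hxy (φ k)).le
  exact ⟨l, isClosed_closure.mem_of_tendsto hyl (Eventually.of_forall fun k ↦ hy (φ k)),
    φ, hφ, hyl⟩
end

section
/- Let X be a reflexive real Banach space and Y a real Banach space such that every bounded linear operator from Y to X is completely continuous, i.e. maps weakly convergent sequences to norm-convergent sequences (this holds whenever Y has the Dunford–Pettis property, since X is reflexive). Let T : X → Y be a bounded linear operator with ‖T‖ = 1 and suppose there exist a bounded linear operator B : Y → X with ‖B‖ ≤ 1 and a sequence (y_n) in Y with ‖y_n‖ = 1 for all n and ‖T(B y_n) − y_n‖ → 0. Then T attains its norm. -/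
open Filter Topology

/-- A normed space is reflexive if the canonical embedding into the bidual is surjective. -/
def IsReflexiveSpace (X : Type*) [NormedAddCommGroup X] [NormedSpace ℝ X] : Prop :=
  Function.Surjective (NormedSpace.inclusionInDoubleDual ℝ X)

/-- In a reflexive space, bounded sequences converge weakly along every ultrafilter. -/
theorem IsReflexiveSpace.exists_ultrafilter_weak_limit {X : Type*} [NormedAddCommGroup X]
    [NormedSpace ℝ X] (hX : IsReflexiveSpace X) {ι : Type*} (U : Ultrafilter ι) {x : ι → X}
    {r : ℝ} (hx : ∀ i, ‖x i‖ ≤ r) :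
    ∃ z : X, ‖z‖ ≤ r ∧ ∀ f : X →L[ℝ] ℝ, Tendsto (fun i => f (x i)) U (𝓝 (f z)) := by
  let e : ι → WeakDual ℝ (StrongDual ℝ X) := fun i =>
    StrongDual.toWeakDual (NormedSpace.inclusionInDoubleDual ℝ X (x i))
  obtain ⟨w, hw, hlim⟩ := (WeakDual.isCompact_closedBall (𝕜 := ℝ)
    (0 : StrongDual ℝ (StrongDual ℝ X)) r).ultrafilter_le_nhds (U.map e) (by
      rw [le_principal_iff]
      refine Filter.mem_map.2 (univ_mem' fun i => ?_)
      have h := ((NormedSpace.inclusionInDoubleDualLi ℝ (E := X)).norm_map (x i)).trans_le (hx i)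
      exact mem_closedBall_zero_iff.2 h)
  obtain ⟨z, hz⟩ := hX (WeakDual.toStrongDual w)
  refine ⟨z, ?_, fun f => ?_⟩
  · rw [← (NormedSpace.inclusionInDoubleDualLi ℝ (E := X)).norm_map z]
    have h : ‖WeakDual.toStrongDual w‖ ≤ r := mem_closedBall_zero_iff.1 hw
    rw [← hz] at h
    exact h
  · have h : w f = f z := (DFunLike.congr_fun hz f).symm
    rw [← h]
    exact ((WeakDual.eval_continuous f).tendsto w).comp (show Tendsto e U (𝓝 w) from hlim)

/-- A separable subspace of a normed space is separated by countably many functionals. -/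
theorem Submodule.exists_seq_separating_of_isSeparable {X : Type*} [NormedAddCommGroup X]
    [NormedSpace ℝ X] {M : Submodule ℝ X} (hM : TopologicalSpace.IsSeparable (M : Set X)) :
    ∃ f : ℕ → X →L[ℝ] ℝ, (∀ k, ‖f k‖ ≤ 1) ∧ ∀ z ∈ M, (∀ k, f k z = 0) → z = 0 := by
  obtain ⟨c, hc, hMc⟩ := hM
  obtain ⟨d, hd⟩ := (hc.insert 0).exists_eq_range (Set.insert_nonempty 0 c)
  choose f hf hfd using fun k => exists_dual_vector'' ℝ (d k)
  refine ⟨f, hf, fun z hz h0 => ?_⟩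
  have hzd : z ∈ closure (Set.range d) := closure_mono (hd ▸ Set.subset_insert 0 c) (hMc hz)
  rw [← norm_le_zero_iff]
  refine le_of_forall_pos_le_add fun ε hε => ?_
  obtain ⟨_, ⟨k, rfl⟩, hk⟩ := Metric.mem_closure_iff.1 hzd (ε / 2) (half_pos hε)
  have hdk : ‖d k‖ ≤ ‖d k - z‖ := by
    calc ‖d k‖ = f k (d k - z) := by rw [map_sub, h0, sub_zero, hfd]; rfl
      _ ≤ ‖f k (d k - z)‖ := le_abs_self _
      _ ≤ 1 * ‖d k - z‖ := (f k).le_of_opNorm_le (hf k) _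
      _ = ‖d k - z‖ := one_mul _
  have hz' : ‖z‖ ≤ ‖z - d k‖ + ‖d k‖ := by simpa using norm_add_le (z - d k) (d k)
  rw [dist_eq_norm] at hk
  rw [norm_sub_rev] at hdk
  linarith

/-- In a reflexive space, every bounded sequence has a weakly convergent subsequence. -/
theorem IsReflexiveSpace.exists_subseq_weak_limit {X : Type*} [NormedAddCommGroup X]
    [NormedSpace ℝ X] (hX : IsReflexiveSpace X) {x : ℕ → X} {r : ℝ} (hx : ∀ n, ‖x n‖ ≤ r) :
    ∃ z : X, ‖z‖ ≤ r ∧ ∃ φ : ℕ → ℕ, StrictMono φ ∧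
      ∀ f : X →L[ℝ] ℝ, Tendsto (fun n => f (x (φ n))) atTop (𝓝 (f z)) := by
  let M : Submodule ℝ X := (Submodule.span ℝ (Set.range x)).topologicalClosure
  have hM : TopologicalSpace.IsSeparable (M : Set X) :=
    ((Set.countable_range x).isSeparable.span (R := ℝ)).closure
  have hxM (n : ℕ) : x n ∈ M :=
    Submodule.le_topologicalClosure _ (Submodule.subset_span ⟨n, rfl⟩)
  have hMclosed : IsClosed (M : Set X) := Submodule.isClosed_topologicalClosure _
  obtain ⟨f, hf, hfM⟩ := Submodule.exists_seq_separating_of_isSeparable hM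
  obtain ⟨a, -, φ, hφ, ha⟩ := (isCompact_univ_pi fun _ : ℕ =>
    isCompact_closedBall (0 : ℝ) r).tendsto_subseq (x := fun n k => f k (x n)) fun n k _ => by
      rw [mem_closedBall_zero_iff]
      exact ((f k).le_of_opNorm_le (hf k) _).trans ((one_mul _).trans_le (hx n))
  rw [tendsto_pi_nhds] at ha
  choose z hz hlim using fun U : Ultrafilter ℕ =>
    hX.exists_ultrafilter_weak_limit U fun n => hx (φ n)
  have hzM (U : Ultrafilter ℕ) : z U ∈ M := by
    by_contra hU
    obtain ⟨g, u, hgM, hgz⟩ := geometric_hahn_banach_closed_point M.convex hMclosed hU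
    exact hgz.not_ge (le_of_tendsto (hlim U g) (Eventually.of_forall fun n => (hgM _ (hxM _)).le))
  have hza {U : Ultrafilter ℕ} (hU : ↑U ≤ (atTop : Filter ℕ)) (k : ℕ) : f k (z U) = a k :=
    tendsto_nhds_unique (hlim U (f k)) ((ha k).mono_left hU)
  have hU₀ : ↑(Ultrafilter.of (atTop : Filter ℕ)) ≤ (atTop : Filter ℕ) := Ultrafilter.of_le _
  refine ⟨z (Ultrafilter.of atTop), hz _, φ, hφ, fun g => ?_⟩
  rw [tendsto_iff_ultrafilter]
  intro U hU
  have hzU : z U = z (Ultrafilter.of atTop) := sub_eq_zero.1 <|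
    hfM _ (M.sub_mem (hzM _) (hzM _)) fun k => by rw [map_sub, hza hU, hza hU₀, sub_self]
  exact hzU ▸ hlim U g

theorem V_operator_attains_norm_of_completely_continuous
    (X Y : Type*) [NormedAddCommGroup X] [NormedSpace ℝ X] [CompleteSpace X]
    [NormedAddCommGroup Y] [NormedSpace ℝ Y] [CompleteSpace Y]
    (hrefl : IsReflexiveSpace X)
    (hcc : ∀ (B : Y →L[ℝ] X) (v : ℕ → Y) (v₀ : Y),
      (∀ f : Y →L[ℝ] ℝ, Tendsto (fun n => f (v n)) atTop (nhds (f v₀))) →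
      Tendsto (fun n => ‖B (v n) - B v₀‖) atTop (nhds 0))
    (T : X →L[ℝ] Y) (hT : ‖T‖ = 1)
    (B : Y →L[ℝ] X) (hB : ‖B‖ ≤ 1)
    (y : ℕ → Y) (hy : ∀ n, ‖y n‖ = 1)
    (hTB : Tendsto (fun n => ‖T (B (y n)) - y n‖) atTop (nhds 0)) :
    NormAttains T := by
  obtain ⟨x, hx, φ, hφ, hlim⟩ := hrefl.exists_subseq_weak_limit (x := fun n => B (y n)) fun n =>
    (B.le_of_opNorm_le hB (y n)).trans (by rw [hy, one_mul])
  have hsub : Tendsto (fun n => T (B (y (φ n))) - y (φ n)) atTop (𝓝 0) :=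
    (tendsto_zero_iff_norm_tendsto_zero.2 hTB).comp hφ.tendsto_atTop
  have hyw (f : Y →L[ℝ] ℝ) : Tendsto (fun n => f (y (φ n))) atTop (𝓝 (f (T x))) := by
    simpa using (hlim (f.comp T)).sub ((f.continuous.tendsto 0).comp hsub)
  have hBy : Tendsto (fun n => B (y (φ n))) atTop (𝓝 (B (T x))) :=
    tendsto_iff_norm_sub_tendsto_zero.2 (hcc B _ _ hyw)
  have hBT : B (T x) = x := (SeparatingDual.eq_iff_forall_dual_eq (R := ℝ)).2 fun f =>
    tendsto_nhds_unique ((f.continuous.tendsto _).comp hBy) (hlim f)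
  have hyn : Tendsto (fun n => y (φ n)) atTop (𝓝 (T x)) := by
    simpa [hBT] using ((T.continuous.tendsto _).comp hBy).sub hsub
  refine ⟨x, hx, ?_⟩
  rw [hT]
  exact tendsto_nhds_unique hyn.norm (by simp [hy])
end

section
/- Let X and Y be real Banach spaces with Y ≠ {0}. If the pair (X, Y) has the compact perturbation property, then X is reflexive. -/
open Filter Topology

section James

variable {X : Type*} [NormedAddCommGroup X] [NormedSpace ℝ X]

/-- **Goldstine's theorem**, in terms of finitely many functionals. -/
theorem exists_norm_le_one_forall_abs_sub_lt (F : StrongDual ℝ (StrongDual ℝ X)) (hF : ‖F‖ ≤ 1)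
    (s : Finset (StrongDual ℝ X)) {ε : ℝ} (hε : 0 < ε) :
    ∃ x : X, ‖x‖ ≤ 1 ∧ ∀ f ∈ s, |f x - F f| < ε := by
  classical
  let A : X →L[ℝ] (s → ℝ) := ContinuousLinearMap.pi fun f => (f : StrongDual ℝ X)
  let p : s → ℝ := fun f => F f
  have hp : p ∈ closure (A '' Metric.closedBall 0 1) := by
    by_contra hp
    obtain ⟨c, u, hc, hu⟩ := geometric_hahn_banach_closed_point
      (((convex_closedBall (0 : X) 1).linear_image A.toLinearMap).closure) isClosed_closure hp
    let w : s → ℝ := fun i => c (Pi.single i 1)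
    have hcw : ∀ v : s → ℝ, c v = ∑ i, w i * v i := by
      intro v
      conv_lhs => rw [pi_eq_sum_univ' v]
      simp only [map_sum, map_smul, smul_eq_mul, w]
      exact Finset.sum_congr rfl fun i _ => mul_comm _ _
    let φ : StrongDual ℝ X := ∑ i : s, w i • (i : StrongDual ℝ X)
    have hφ : ∀ x, φ x = c (A x) := by
      intro x
      simp [φ, hcw, A]
    have hb : ∀ x : X, ‖x‖ ≤ 1 → φ x < u := fun x hx => by
      rw [hφ]
      exact hc _ (subset_closure ⟨x, by simpa using hx, rfl⟩)
    have hu0 : 0 < u := by simpa using hb 0 (by simp)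
    have hnorm : ‖φ‖ ≤ u := by
      refine φ.opNorm_le_of_unit_norm hu0.le fun x hx => ?_
      rw [Real.norm_eq_abs, abs_le]
      have h1 := hb x hx.le
      have h2 := hb (-x) (by simp [hx])
      rw [map_neg] at h2
      constructor <;> linarith
    have h1 : F φ = c p := by simp [φ, hcw, p]
    have h2 : F φ ≤ u := calc
      F φ ≤ ‖F φ‖ := Real.le_norm_self _
      _ ≤ ‖F‖ * ‖φ‖ := F.le_opNorm _
      _ ≤ 1 * ‖φ‖ := by gcongr
      _ ≤ u := by simpa using hnorm
    linarith
  obtain ⟨_, ⟨x, hx, rfl⟩, hd⟩ := Metric.mem_closure_iff.1 hp ε hε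
  refine ⟨x, by simpa using hx, fun f hf => ?_⟩
  have := (dist_le_pi_dist p (A x) ⟨f, hf⟩).trans_lt hd
  rw [Real.dist_eq, abs_sub_comm] at this
  simpa [A, p] using this

set_option maxSynthPendingDepth 6 in
/-- A nonreflexive Banach space carries a triangular system of vectors and functionals. -/
theorem exists_triangular_system_of_not_isReflexiveSpace [CompleteSpace X]
    (hX : ¬ IsReflexiveSpace X) :
    ∃ θ : ℝ, 0 < θ ∧ ∃ (f : ℕ → StrongDual ℝ X) (x : ℕ → X),
      (∀ n, ‖f n‖ ≤ 1) ∧ (∀ n, ‖x n‖ ≤ 1) ∧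
      (∀ n k, n ≤ k → 2 * θ ≤ f n (x k)) ∧ ∀ n k, k < n → f n (x k) ≤ θ := by
  classical
  let J := NormedSpace.inclusionInDoubleDualLi ℝ (E := X)
  obtain ⟨F₀, hF₀⟩ : ∃ F₀, F₀ ∉ LinearMap.range J.toLinearMap := by
    by_contra! hcon
    exact hX fun F => hcon F
  have hclosed : IsClosed (LinearMap.range J.toLinearMap : Set (StrongDual ℝ (StrongDual ℝ X))) := by
    rw [LinearMap.coe_range]
    exact J.isometry.isUniformInducing.isComplete_range.isClosed
  obtain ⟨G₀, u, hGu, hG⟩ : ∃ (G₀ : StrongDual ℝ (StrongDual ℝ (StrongDual ℝ X))) (u : ℝ),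
      G₀ F₀ < u ∧ ∀ b ∈ LinearMap.range J.toLinearMap, u < G₀ b := geometric_hahn_banach_point_closed
    (LinearMap.range J.toLinearMap).convex hclosed hF₀
  have hu : u < 0 := by simpa using hG 0 (Submodule.zero_mem _)
  have hGJ : ∀ x, G₀ (J x) = 0 := by
    intro x
    by_contra hne
    have := hG (J ((u / G₀ (J x)) • x)) ⟨_, rfl⟩
    rw [map_smul, map_smul, smul_eq_mul, div_mul_cancel₀ _ hne] at this
    exact lt_irrefl _ this
  have hGF : G₀ F₀ < 0 := hGu.trans hu
  have hG0 : 0 < ‖G₀‖ := norm_pos_iff.2 fun h => by simp [h] at hGF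
  have hF0 : 0 < ‖F₀‖ := norm_pos_iff.2 fun h => by simp [h] at hGF
  let F := ‖F₀‖⁻¹ • F₀
  let G : StrongDual ℝ (StrongDual ℝ (StrongDual ℝ X)) := (-‖G₀‖⁻¹) • G₀
  have hF : ‖F‖ ≤ 1 := by simp [F, norm_smul, hF0.ne']
  have hGn : ‖G‖ ≤ 1 := by simp [G, norm_smul, hG0.ne']
  have hGJ' : ∀ x, G (J x) = 0 := fun x => by simp [G, hGJ]
  have hpos : 0 < G F := by
    have : G F = ‖G₀‖⁻¹ * ‖F₀‖⁻¹ * (-G₀ F₀) := by simp [G, F]; ring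
    rw [this]
    have : 0 < -G₀ F₀ := by linarith
    positivity
  obtain ⟨θ, hθ⟩ : ∃ θ, θ = G F / 4 := ⟨_, rfl⟩
  have hθ0 : 0 < θ := by rw [hθ]; positivity
  obtain ⟨q, hq, hqr⟩ := exists_seq_of_forall_finset_exists
    (fun p : StrongDual ℝ X × X => ‖p.1‖ ≤ 1 ∧ ‖p.2‖ ≤ 1 ∧ 3 * θ < F p.1 ∧ 2 * θ ≤ p.1 p.2)
    (fun p q => 2 * θ ≤ p.1 q.2 ∧ q.1 p.2 ≤ θ) (by
      intro s hs
      obtain ⟨f, hf, hfs⟩ := exists_norm_le_one_forall_abs_sub_lt G hGn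
        (insert F (s.image fun p => J p.2)) hθ0
      obtain ⟨x, hx, hxs⟩ := exists_norm_le_one_forall_abs_sub_lt F hF
        (insert f (s.image Prod.fst)) hθ0
      have hFf : 3 * θ < F f := by
        have := abs_lt.1 (hfs F (Finset.mem_insert_self _ _))
        linarith
      refine ⟨(f, x), ⟨hf, hx, hFf, ?_⟩, fun p hp => ⟨?_, ?_⟩⟩
      · have := abs_lt.1 (hxs f (Finset.mem_insert_self _ _))
        simp only
        linarith
      · have := abs_lt.1 (hxs p.1 (Finset.mem_insert_of_mem (Finset.mem_image_of_mem _ hp)))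
        have := (hs p hp).2.2.1
        simp only
        linarith
      · have := hfs (J p.2) (Finset.mem_insert_of_mem
          (Finset.mem_image_of_mem (fun p : StrongDual ℝ X × X => J p.2) hp))
        rw [hGJ', sub_zero] at this
        exact (le_abs_self _).trans this.le)
  refine ⟨θ, hθ0, fun n => (q n).1, fun n => (q n).2, fun n => (hq n).1, fun n => (hq n).2.1,
    fun n k hnk => ?_, fun n k hkn => (hqr k n hkn).2⟩
  rcases hnk.eq_or_lt with rfl | hlt
  · exact (hq n).2.2.2
  · exact (hqr n k hlt).1

/-- A decreasing sequence of nonempty convex subsets of the dual unit ball. -/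
structure IsConvexTower (C : ℕ → Set (StrongDual ℝ X)) : Prop where
  antitone : Antitone C
  convex : ∀ k, Convex ℝ (C k)
  nonempty : ∀ k, (C k).Nonempty
  norm_le_one : ∀ k, ∀ f ∈ C k, ‖f‖ ≤ 1

/-- `h - g` is eventually at most `a` along the tower `C`, pointwise on the unit ball. -/
def EventuallyBelow (C : ℕ → Set (StrongDual ℝ X)) (h : StrongDual ℝ X) (a : ℝ) : Prop :=
  ∀ x : X, ‖x‖ ≤ 1 → ∃ k, ∀ g ∈ C k, h x - g x ≤ a

/-- The bounds that can be achieved for `S + σ • g`, with `g` in the first level of `C`, by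
passing to a smaller tower. -/
def towerBounds (C : ℕ → Set (StrongDual ℝ X)) (S : StrongDual ℝ X) (σ : ℝ) : Set ℝ :=
  {a | ∃ g ∈ C 0, ∃ D, D ≤ C ∧ IsConvexTower D ∧ EventuallyBelow D (S + σ • g) a}

theorem EventuallyBelow.mono {C D : ℕ → Set (StrongDual ℝ X)} {h : StrongDual ℝ X} {a b : ℝ}
    (H : EventuallyBelow C h a) (hDC : D ≤ C) (hab : a ≤ b) : EventuallyBelow D h b :=
  fun x hx => (H x hx).imp fun k hk g hg => (hk g (hDC k hg)).trans hab

theorem IsConvexTower.towerBounds_nonempty {C : ℕ → Set (StrongDual ℝ X)} (hC : IsConvexTower C)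
    (S : StrongDual ℝ X) (σ : ℝ) : (towerBounds C S σ).Nonempty := by
  obtain ⟨g, hg⟩ := hC.nonempty 0
  refine ⟨‖S + σ • g‖ + 1, g, hg, C, le_rfl, hC, fun x hx => ⟨0, fun f hf => ?_⟩⟩
  have h1 := (S + σ • g).le_of_opNorm_le_of_le le_rfl hx
  have h2 := f.le_of_opNorm_le_of_le (hC.norm_le_one 0 f hf) hx
  rw [Real.norm_eq_abs, abs_le] at h1 h2
  linarith

theorem bddBelow_towerBounds (C : ℕ → Set (StrongDual ℝ X)) (S : StrongDual ℝ X) (σ : ℝ) :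
    BddBelow (towerBounds C S σ) := by
  refine ⟨0, ?_⟩
  rintro a ⟨g, -, D, -, hD, hb⟩
  obtain ⟨k, hk⟩ := hb 0 (by simp)
  obtain ⟨f, hf⟩ := hD.nonempty k
  simpa using hk f hf

theorem IsConvexTower.exists_step {C : ℕ → Set (StrongDual ℝ X)} (hC : IsConvexTower C)
    (S : StrongDual ℝ X) (σ : ℝ) {ε : ℝ} (hε : 0 < ε) :
    ∃ g ∈ C 0, ∃ D, IsConvexTower D ∧ (∀ k, D k ⊆ C (k + 1)) ∧
      EventuallyBelow D (S + σ • g) (sInf (towerBounds C S σ) + ε) ∧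
      ∃ x : X, ‖x‖ ≤ 1 ∧ ∀ f ∈ D 0, sInf (towerBounds C S σ) - ε ≤ (S + σ • g) x - f x := by
  obtain ⟨a, ⟨g, hg, D, hDC, hD, hb⟩, ha⟩ := Real.lt_sInf_add_pos
    (hC.towerBounds_nonempty S σ) hε
  have hnot : ¬ EventuallyBelow D (S + σ • g) (sInf (towerBounds C S σ) - ε) := fun hcon => by
    have := csInf_le (bddBelow_towerBounds C S σ) ⟨g, hg, D, hDC, hD, hcon⟩
    linarith
  simp only [EventuallyBelow, not_forall, not_exists, not_le] at hnot
  obtain ⟨x, hx, hxD⟩ := hnot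
  set m := sInf (towerBounds C S σ)
  refine ⟨g, hg, fun k => D (k + 1) ∩ {f | m - ε < (S + σ • g) x - f x}, ⟨?_, ?_, ?_, ?_⟩, ?_, ?_,
    x, hx, fun f hf => hf.2.le⟩
  · exact fun i j hij => Set.inter_subset_inter_left _ (hD.antitone (by omega))
  · refine fun k => (hD.convex _).inter ?_
    intro f hf f' hf' s t hs ht hst
    simp only [Set.mem_ofPred_eq, add_apply, smul_apply,
      smul_eq_mul] at *
    have hs' : s = 1 - t := by linarith
    subst hs'
    rcases ht.eq_or_lt with rfl | ht
    · simpa using hf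
    · nlinarith [mul_le_mul_of_nonneg_left hf.le hs, mul_lt_mul_of_pos_left hf' ht]
  · intro k
    obtain ⟨f, hf, hfx⟩ := hxD (k + 1)
    exact ⟨f, hf, hfx⟩
  · exact fun k f hf => hD.norm_le_one _ f hf.1
  · exact fun k f hf => hDC _ hf.1
  · exact hb.mono (fun k f hf => hD.antitone (Nat.le_succ k) hf.1) ha.le

theorem towerBounds_subset {C D : ℕ → Set (StrongDual ℝ X)} (hC : Convex ℝ (C 0)) (hDC : D ≤ C)
    {g S : StrongDual ℝ X} (hg : g ∈ C 0) {r σ : ℝ} (hr0 : 0 ≤ r) (hr1 : r ≤ 1) :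
    towerBounds D (S + ((1 - r) * σ) • g) (σ * r) ⊆ towerBounds C S σ := by
  rintro a ⟨f, hf, E, hED, hE, hb⟩
  refine ⟨(1 - r) • g + r • f, hC hg (hDC 0 hf) (by linarith) hr0 (by ring), E, hED.trans hDC,
    hE, ?_⟩
  convert hb using 1
  module

theorem IsConvexTower.exists_sequence {C₀ : ℕ → Set (StrongDual ℝ X)} (hC₀ : IsConvexTower C₀)
    {r : ℝ} (hr0 : 0 ≤ r) (hr1 : r ≤ 1) {ε : ℕ → ℝ} (hε : ∀ n, 0 < ε n) :
    ∃ (S g : ℕ → StrongDual ℝ X) (C : ℕ → ℕ → Set (StrongDual ℝ X)) (α : ℕ → ℝ),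
      S 0 = 0 ∧ (∀ n, S (n + 1) = S n + ((1 - r) * r ^ n) • g n) ∧
      (∀ n, g n ∈ C n 0) ∧ (∀ n, IsConvexTower (C n)) ∧ (∀ n k, C (n + 1) k ⊆ C n (k + 1)) ∧
      (∀ n, EventuallyBelow (C (n + 1)) (S n + r ^ n • g n) (α n + ε n)) ∧
      (∀ n, ∃ x : X, ‖x‖ ≤ 1 ∧ ∀ f ∈ C (n + 1) 0, α n - ε n ≤ (S n + r ^ n • g n) x - f x) ∧
      Monotone α ∧ α 0 = sInf (towerBounds C₀ 0 1) := by
  choose! g hg D hD hDC hb hx using fun (n : ℕ) (S : StrongDual ℝ X)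
    (C : ℕ → Set (StrongDual ℝ X)) (hC : IsConvexTower C) => hC.exists_step S (r ^ n) (hε n)
  let p : ℕ → StrongDual ℝ X × (ℕ → Set (StrongDual ℝ X)) := fun n =>
    Nat.rec (0, C₀) (fun n q => (q.1 + ((1 - r) * r ^ n) • g n q.1 q.2, D n q.1 q.2)) n
  have hp : ∀ n, IsConvexTower (p n).2 := by
    intro n
    induction n with
    | zero => exact hC₀
    | succ n ih => exact hD n _ _ ih
  refine ⟨fun n => (p n).1, fun n => g n (p n).1 (p n).2, fun n => (p n).2,
    fun n => sInf (towerBounds (p n).2 (p n).1 (r ^ n)), rfl, fun n => rfl,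
    fun n => hg n _ _ (hp n), hp, fun n => hDC n _ _ (hp n), fun n => hb n _ _ (hp n),
    fun n => hx n _ _ (hp n), monotone_nat_of_le_succ fun n => ?_, by simp [p]⟩
  refine csInf_le_csInf (bddBelow_towerBounds _ _ _) ((hp (n + 1)).towerBounds_nonempty _ _) ?_
  exact towerBounds_subset ((hp n).convex 0)
    (fun k => (hDC n _ _ (hp n) k).trans ((hp n).antitone (Nat.le_succ k)))
    (hg n _ _ (hp n)) hr0 hr1

/-- A sequence in the dual unit ball converges pointwise along a nonprincipal ultrafilter. -/
theorem exists_tendsto_hyperfilter (g : ℕ → StrongDual ℝ X) (hg : ∀ n, ‖g n‖ ≤ 1) :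
    ∃ w : StrongDual ℝ X, ‖w‖ ≤ 1 ∧
      ∀ x, Tendsto (fun n => g n x) (hyperfilter ℕ : Filter ℕ) (𝓝 (w x)) := by
  obtain ⟨w, hw, hlim⟩ :=
    (WeakDual.isCompact_closedBall (0 : StrongDual ℝ X) 1).ultrafilter_le_nhds
    ((hyperfilter ℕ).map fun n => StrongDual.toWeakDual (g n)) (by
      rw [Filter.le_principal_iff, Ultrafilter.mem_coe, Ultrafilter.mem_map]
      exact Filter.univ_mem' fun n => by simpa using hg n)
  exact ⟨WeakDual.toStrongDual w, by simpa using hw,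
    fun x => ((WeakDual.eval_continuous x).tendsto w).comp hlim⟩

/-- A tower whose bounds stay away from zero yields a functional not attaining its norm. -/
theorem IsConvexTower.exists_not_normAttains {C₀ : ℕ → Set (StrongDual ℝ X)}
    (hC₀ : IsConvexTower C₀) {θ : ℝ} (hθ : 0 < θ) (hθC : ∀ a ∈ towerBounds C₀ 0 1, θ ≤ a) :
    ∃ H : StrongDual ℝ X, ¬ NormAttains H := by
  obtain ⟨r, hr⟩ : ∃ r, r = min (θ / 8) (1 / 2) := ⟨_, rfl⟩
  have hr0 : 0 < r := by rw [hr]; positivity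
  have hrθ : r ≤ θ / 8 := hr ▸ min_le_left _ _
  have hr1 : r ≤ 1 / 2 := hr ▸ min_le_right _ _
  obtain ⟨S, g, C, α, hS0, hS, hg, hC, hCC, hub, hlb, hα, hα0⟩ :=
    hC₀.exists_sequence hr0.le (by linarith)
      (ε := fun n => θ / 2 * (r / 2) ^ (n + 1)) (fun n => by positivity)
  set ε : ℕ → ℝ := fun n => θ / 2 * (r / 2) ^ (n + 1) with hε
  have hgn : ∀ n, ‖g n‖ ≤ 1 := fun n => (hC n).norm_le_one 0 _ (hg n)
  have hCadd : ∀ n k m, C (n + m) k ⊆ C n (m + k) := by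
    intro n k m
    induction m generalizing k with
    | zero => simp
    | succ m ih =>
      rw [show m + 1 + k = m + (k + 1) by ring]
      exact (hCC (n + m) k).trans (ih (k + 1))
  have hgC : ∀ n m, g (n + m) ∈ C n m := fun n m => hCadd n 0 m (hg (n + m))
  obtain ⟨w, hwn, hw⟩ := exists_tendsto_hyperfilter g hgn
  have hev : ∀ n k, ∀ᶠ m in (hyperfilter ℕ : Filter ℕ), g m ∈ C n k := by
    intro n k
    refine (Nat.hyperfilter_le_atTop) ((eventually_ge_atTop (n + k)).mono fun m hm => ?_)
    obtain ⟨j, rfl⟩ := Nat.exists_eq_add_of_le ((Nat.le_add_right n k).trans hm)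
    exact (hC n).antitone (by omega) (hgC n j)
  have hupper : ∀ n, ‖S n + r ^ n • g n - w‖ ≤ α n + ε n := by
    intro n
    have key : ∀ x : X, ‖x‖ ≤ 1 → (S n + r ^ n • g n - w) x ≤ α n + ε n := by
      intro x hx
      obtain ⟨k, hk⟩ := hub n x hx
      exact le_of_tendsto ((hw x).const_sub ((S n + r ^ n • g n) x))
        ((hev (n + 1) k).mono fun m hm => hk _ hm)
    refine ContinuousLinearMap.opNorm_le_of_unit_norm (by simpa using key 0 (by simp))
      fun x hx => ?_
    have h1 := key x hx.le
    have h2 := key (-x) (by simp [hx])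
    rw [map_neg] at h2
    rw [Real.norm_eq_abs, abs_le]
    constructor <;> linarith
  have hlower : ∀ n, α n - ε n ≤ ‖S n + r ^ n • g n - w‖ := by
    intro n
    obtain ⟨x, hx, hxf⟩ := hlb n
    have h1 : α n - ε n ≤ (S n + r ^ n • g n - w) x :=
      ge_of_tendsto ((hw x).const_sub ((S n + r ^ n • g n) x))
        ((hev (n + 1) 0).mono fun m hm => hxf _ hm)
    exact h1.trans ((Real.le_norm_self _).trans
      (by simpa using (S n + r ^ n • g n - w).le_of_opNorm_le_of_le le_rfl hx))
  have hSdist : ∀ n, dist (S n) (S (n + 1)) ≤ (1 - r) * r ^ n := by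
    intro n
    rw [dist_eq_norm, hS, sub_add_cancel_left, norm_neg, norm_smul, Real.norm_of_nonneg
      (mul_nonneg (by linarith) (by positivity))]
    exact mul_le_of_le_one_right (mul_nonneg (by linarith) (by positivity)) (hgn n)
  obtain ⟨L, hL⟩ := cauchySeq_tendsto_of_complete
    (cauchySeq_of_le_geometric r (1 - r) (by linarith) hSdist)
  have hSL : ∀ n, ‖L - S n‖ ≤ r ^ n := by
    intro n
    have := dist_le_of_le_geometric_of_tendsto r (1 - r) (by linarith) hSdist hL n
    rwa [mul_div_cancel_left₀ _ (by linarith : (1 - r) ≠ 0), dist_comm, dist_eq_norm] at this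
  have hrlim : Tendsto (fun n => r ^ n) atTop (𝓝 0) :=
    tendsto_pow_atTop_nhds_zero_of_lt_one hr0.le (by linarith)
  have hεlim : Tendsto ε atTop (𝓝 0) := by
    have := ((tendsto_pow_atTop_nhds_zero_of_lt_one (by positivity : 0 ≤ r / 2)
      (by linarith)).comp (tendsto_add_atTop_nat 1)).const_mul (θ / 2)
    simpa using this
  set A := ‖L - w‖ with hA
  have hαA : ∀ n, α n ≤ A := by
    intro n
    have hlim : Tendsto (fun m => A + 2 * r ^ m + ε m) atTop (𝓝 A) := by
      simpa using ((hrlim.const_mul 2).const_add A).add hεlim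
    refine ge_of_tendsto hlim ((eventually_ge_atTop n).mono fun m hm => ?_)
    have h1 := hα hm
    have h2 := hlower m
    have h3 : ‖S m + r ^ m • g m - w‖ ≤ A + 2 * r ^ m := by
      have h4 : S m + r ^ m • g m - w = (L - w) - (L - S m) + r ^ m • g m := by abel
      have h5 : ‖r ^ m • g m‖ ≤ r ^ m := by
        rw [norm_smul, Real.norm_of_nonneg (by positivity)]
        exact mul_le_of_le_one_right (by positivity) (hgn m)
      rw [h4]
      linarith [norm_add_le ((L - w) - (L - S m)) (r ^ m • g m), norm_sub_le (L - w) (L - S m),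
        hSL m]
    linarith
  have hθA : θ ≤ A := by
    refine le_trans ?_ (hαA 0)
    rw [hα0]
    exact le_csInf (hC₀.towerBounds_nonempty 0 1) hθC
  let T : ℕ → StrongDual ℝ X := fun n => S n - (1 - r ^ n) • w
  have hT : ∀ n, ‖T n‖ ≤ A * (1 - r ^ n) + θ / 2 * r ^ n * (1 - (1 / 2) ^ n) := by
    intro n
    induction n with
    | zero => simp [T, hS0]
    | succ n ih =>
      have hrec : T (n + 1) = (1 - r) • (S n + r ^ n • g n - w) + r • T n := by
        simp only [T, hS, pow_succ]
        module
      have h1 : ‖T (n + 1)‖ ≤ (1 - r) * (A + ε n) + r * ‖T n‖ := by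
        rw [hrec]
        refine (norm_add_le _ _).trans ?_
        rw [norm_smul, norm_smul, Real.norm_of_nonneg hr0.le, Real.norm_of_nonneg
          (by linarith : 0 ≤ 1 - r)]
        gcongr
        · linarith
        · exact (hupper n).trans (by linarith [hαA n])
      have h2 : (1 - r) * ε n ≤ ε n :=
        mul_le_of_le_one_left (by simp only [hε]; positivity) (by linarith)
      have h3 : ε n = θ / 2 * r ^ (n + 1) * (1 / 2) ^ (n + 1) := by
        simp only [hε, div_pow, one_pow]; ring
      have h4 := mul_le_mul_of_nonneg_left ih hr0.le
      calc ‖T (n + 1)‖ ≤ (1 - r) * A + θ / 2 * r ^ (n + 1) * (1 / 2) ^ (n + 1) +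
            r * (A * (1 - r ^ n) + θ / 2 * r ^ n * (1 - (1 / 2) ^ n)) := by linarith
        _ = A * (1 - r ^ (n + 1)) + θ / 2 * r ^ (n + 1) * (1 - (1 / 2) ^ (n + 1)) := by
          ring
  refine ⟨L - w, ?_⟩
  rintro ⟨x₀, hx₀, hatt⟩
  obtain ⟨x, hx, hxA⟩ : ∃ x : X, ‖x‖ ≤ 1 ∧ (L - w) x = A := by
    rcases abs_choice ((L - w) x₀) with h | h
    · exact ⟨x₀, hx₀, by rw [← h]; exact hatt⟩
    · exact ⟨-x₀, by simpa using hx₀, by rw [map_neg, ← h]; exact hatt⟩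
  have happ : ∀ f : StrongDual ℝ X, f x ≤ ‖f‖ := fun f =>
    (Real.le_norm_self _).trans (by simpa using f.le_of_opNorm_le_of_le le_rfl hx)
  have hgap : ∀ n, θ / 4 ≤ g n x - w x := by
    intro n
    have hrn : 0 < r ^ n := by positivity
    have hdec : L - w = T n + ((1 - r) * r ^ n) • (g n - w) + (L - S (n + 1))
        - r ^ (n + 1) • w := by
      simp only [T, hS, pow_succ]
      module
    have h1 : A = T n x + (1 - r) * r ^ n * (g n x - w x) + (L - S (n + 1)) x
        - r ^ (n + 1) * w x := by
      rw [← hxA, hdec]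
      simp
    have h2 : T n x ≤ A - θ / 2 * r ^ n := by
      have h3 : 0 ≤ θ / 2 * r ^ n * (1 / 2) ^ n := by positivity
      have h4 : θ * r ^ n ≤ A * r ^ n := by gcongr
      linarith [happ (T n), hT n]
    have h3 := (happ (L - S (n + 1))).trans (hSL (n + 1))
    have h4 : -w x ≤ 1 := by simpa using (happ (-w)).trans (by simpa using hwn)
    have h5 : r ^ (n + 1) * -w x ≤ r ^ (n + 1) * 1 := by gcongr
    have h6 : r ^ n * (θ / 4) ≤ r ^ n * ((1 - r) * (g n x - w x)) := by
      have h7 : r ^ (n + 1) ≤ r ^ n * (θ / 8) := by rw [pow_succ]; gcongr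
      linarith
    have h7 := le_of_mul_le_mul_left h6 hrn
    nlinarith
  have := ge_of_tendsto ((hw x).sub_const (w x)) (Eventually.of_forall hgap)
  linarith

/-- **James' theorem**: in a nonreflexive Banach space, some functional does not attain its
norm. -/
theorem exists_not_normAttains_of_not_isReflexiveSpace [CompleteSpace X]
    (hX : ¬ IsReflexiveSpace X) : ∃ H : StrongDual ℝ X, ¬ NormAttains H := by
  obtain ⟨θ, hθ, f, x, hf, hx, hle, hlt⟩ := exists_triangular_system_of_not_isReflexiveSpace hX
  let C : ℕ → Set (StrongDual ℝ X) := fun k =>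
    {h | ‖h‖ ≤ 1 ∧ (∀ j < k, h (x j) ≤ θ) ∧ ∃ N, ∀ j, N ≤ j → 2 * θ ≤ h (x j)}
  have hC : IsConvexTower C := by
    refine ⟨fun i j hij h hh => ⟨hh.1, fun k hk => hh.2.1 k (hk.trans_le hij), hh.2.2⟩, ?_,
      fun k => ⟨f k, hf k, fun j hj => hlt k j hj, k, fun j hj => hle k j hj⟩,
      fun k h hh => hh.1⟩
    rintro k h ⟨h1, h2, N, h3⟩ h' ⟨h1', h2', N', h3'⟩ s t hs ht hst
    refine ⟨?_, fun j hj => ?_, max N N', fun j hj => ?_⟩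
    · exact mem_closedBall_zero_iff.1 (convex_closedBall (0 : StrongDual ℝ X) 1
        (mem_closedBall_zero_iff.2 h1) (mem_closedBall_zero_iff.2 h1') hs ht hst)
    · exact convex_Iic θ (h2 j hj) (h2' j hj) hs ht hst
    · exact convex_Ici (2 * θ) (h3 j (le_of_max_le_left hj)) (h3' j (le_of_max_le_right hj))
        hs ht hst
  refine hC.exists_not_normAttains hθ ?_
  rintro a ⟨g, ⟨-, -, N, hN⟩, D, hDC, hD, hb⟩
  obtain ⟨k, hk⟩ := hb (x N) (hx N)
  obtain ⟨h, hh⟩ := hD.nonempty (max k (N + 1))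
  have h1 := hk h (hD.antitone (le_max_left _ _) hh)
  have h2 := (hDC _ hh).2.1 N (lt_of_lt_of_le (Nat.lt_succ_self N) (le_max_right _ _))
  have h3 := hN N le_rfl
  simp only [zero_add, one_smul] at h1
  linarith

end James

theorem CPP_implies_reflexive
    (X Y : Type*) [NormedAddCommGroup X] [NormedSpace ℝ X] [CompleteSpace X]
    [NormedAddCommGroup Y] [NormedSpace ℝ Y] [CompleteSpace Y]
    (hY : ∃ y : Y, y ≠ 0) (h : CPP X Y) :
    IsReflexiveSpace X := by
  by_contra hX
  obtain ⟨H, hH⟩ := exists_not_normAttains_of_not_isReflexiveSpace hX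
  obtain ⟨y, hy⟩ := hY
  have hH0 : H ≠ 0 := by
    rintro rfl
    exact hH ⟨0, by simp, by simp⟩
  have hcomp : IsCompactOperator (H.smulRight y) := by
    refine ⟨(fun t : ℝ => t • y) '' Metric.closedBall 0 1,
      (isCompact_closedBall (0 : ℝ) 1).image (by fun_prop), ?_⟩
    filter_upwards [H.continuous.continuousAt.preimage_mem_nhds
      (Metric.closedBall_mem_nhds (H 0) one_pos)] with x hx
    exact ⟨H x, by simpa using hx, by simp⟩
  obtain ⟨x, hx, hatt⟩ := h 0 (H.smulRight y) hcomp (by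
    rw [zero_add, norm_zero, ContinuousLinearMap.norm_smulRight_apply]
    positivity)
  refine hH ⟨x, hx, ?_⟩
  rw [zero_add, ContinuousLinearMap.norm_smulRight_apply, ContinuousLinearMap.smulRight_apply,
    norm_smul] at hatt
  exact mul_right_cancel₀ (norm_ne_zero_iff.2 hy) hatt
end

section
/- Let X be an infinite-dimensional reflexive real Banach space. Then the pair (X, ℓ∞) does not have the weak maximizing property. -/
open Filter Topology
open scoped ENNReal

section WeakStarLimits

open TopologicalSpace

variable {E : Type*} [NormedAddCommGroup E] [NormedSpace ℝ E]

/-- Banach–Alaoglu along an ultrafilter. -/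
theorem exists_tendsto_apply_of_norm_le {ι : Type*} (U : Ultrafilter ι) (u : ι → E →L[ℝ] ℝ)
    {C : ℝ} (hu : ∀ i, ‖u i‖ ≤ C) :
    ∃ h : E →L[ℝ] ℝ, ∀ x, Tendsto (fun i => u i x) U (𝓝 (h x)) := by
  have hc := WeakDual.isCompact_closedBall (𝕜 := ℝ) (E := E) 0 C
  obtain ⟨a, -, ha⟩ := hc.ultrafilter_le_nhds (U.map fun i => StrongDual.toWeakDual (u i)) (by
    rw [Ultrafilter.coe_map, le_principal_iff]
    refine Filter.mem_map.2 (Filter.univ_mem' fun i => ?_)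
    simpa using! hu i)
  refine ⟨WeakDual.toStrongDual a, fun x => ?_⟩
  exact ((WeakDual.eval_continuous x).tendsto a).comp (show Tendsto _ _ _ from ha)

theorem exists_dual_eq_zero_of_notMem {p : Submodule ℝ E} (hp : IsClosed (p : Set E)) {x : E}
    (hx : x ∉ p) : ∃ f : E →L[ℝ] ℝ, (∀ y ∈ p, f y = 0) ∧ f x ≠ 0 := by
  obtain ⟨f, c, hfx, hfp⟩ := geometric_hahn_banach_point_closed p.convex hp hx
  have h0 : ∀ y ∈ p, f y = 0 := by
    intro y hy
    by_contra hne
    have := hfp _ (p.smul_mem ((c - 1) / f y) hy)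
    rw [map_smul, smul_eq_mul, div_mul_cancel₀ _ hne] at this
    linarith
  refine ⟨f, h0, ?_⟩
  have := hfp 0 p.zero_mem
  rw [map_zero] at this
  linarith

theorem exists_norm_eq_one_lt_apply (hE : Nontrivial E) (f : E →L[ℝ] ℝ) {r : ℝ} (hr : r < ‖f‖) :
    ∃ x : E, ‖x‖ = 1 ∧ r < f x := by
  rcases lt_or_ge r 0 with h0 | h0
  · obtain ⟨x, hx⟩ := exists_norm_eq E zero_le_one
    rcases le_total 0 (f x) with h | h
    · exact ⟨x, hx, by linarith⟩
    · exact ⟨-x, by simpa using hx, by rw [map_neg]; linarith⟩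
  · by_contra! H
    refine hr.not_ge (f.opNorm_le_of_unit_norm h0 fun x hx => ?_)
    refine abs_le.2 ⟨?_, H x hx⟩
    have := H (-x) (by simpa using hx)
    rw [map_neg] at this
    linarith

theorem exists_separating_sequence (V : Submodule ℝ (E →L[ℝ] ℝ)) [SeparableSpace V] :
    ∃ z : ℕ → E, ∀ g ∈ V.topologicalClosure, (∀ k, g (z k) = 0) → g = 0 := by
  have hz : ∀ k, ∃ x : E, ‖x‖ ≤ 1 ∧ ‖(denseSeq V k : E →L[ℝ] ℝ)‖ / 2 ≤
      ‖(denseSeq V k : E →L[ℝ] ℝ) x‖ := by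
    intro k
    rcases eq_or_ne (denseSeq V k : E →L[ℝ] ℝ) 0 with h | h
    · exact ⟨0, by simp, by simp [h]⟩
    · obtain ⟨x, hx, hlt⟩ := (denseSeq V k : E →L[ℝ] ℝ).exists_lt_apply_of_lt_opNorm
        (half_lt_self (norm_pos_iff.2 h))
      exact ⟨x, hx.le, hlt.le⟩
  choose z hz1 hz2 using hz
  refine ⟨z, fun g hg hgz => ?_⟩
  rw [← norm_le_zero_iff]
  refine le_of_forall_pos_lt_add fun ε hε => ?_
  obtain ⟨v, hv, hgv⟩ := Metric.mem_closure_iff.1 hg (ε / 6) (by positivity)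
  obtain ⟨k, hk⟩ := (denseRange_denseSeq V).exists_dist_lt ⟨v, hv⟩ (show 0 < ε / 6 by positivity)
  set w : E →L[ℝ] ℝ := ↑(denseSeq V k)
  have hk' : dist v w < ε / 6 := hk
  have hgw : ‖w - g‖ < ε / 3 := by
    rw [← dist_eq_norm, dist_comm]
    linarith [dist_triangle g v w]
  have h1 : ‖w (z k)‖ ≤ ‖w - g‖ := by
    have := (w - g).unit_le_opNorm (z k) (hz1 k)
    simpa [hgz k] using this
  have h2 : ‖g‖ ≤ ‖w‖ + ‖w - g‖ := by
    have := norm_sub_le w (w - g)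
    simpa using this
  linarith [hz2 k]

theorem not_finiteDimensional_dual (hinf : ¬ FiniteDimensional ℝ E) :
    ¬ FiniteDimensional ℝ (E →L[ℝ] ℝ) := by
  intro h
  let φ : E →ₗ[ℝ] Module.Dual ℝ (E →L[ℝ] ℝ) :=
    { toFun := fun x =>
        { toFun := fun f => f x
          map_add' := fun _ _ => rfl
          map_smul' := fun _ _ => rfl }
      map_add' := fun x y => by ext f; exact map_add f x y
      map_smul' := fun c x => by ext f; exact map_smul f c x }
  refine hinf (FiniteDimensional.of_injective φ fun x y hxy => ?_)
  exact (SeparatingDual.eq_iff_forall_dual_eq (R := ℝ)).2 fun f => LinearMap.congr_fun hxy f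

theorem exists_separable_submodule {F : Type*} [NormedAddCommGroup F] [NormedSpace ℝ F]
    (hF : ¬ FiniteDimensional ℝ F) :
    ∃ V : Submodule ℝ F, SeparableSpace V ∧ ¬ FiniteDimensional ℝ V := by
  let b := Module.Basis.ofVectorSpace ℝ F
  have hI : Infinite (Module.Basis.ofVectorSpaceIndex ℝ F) := by
    by_contra hI
    rw [not_infinite_iff_finite] at hI
    exact hF (Module.Finite.of_basis b)
  let e := Infinite.natEmbedding (Module.Basis.ofVectorSpaceIndex ℝ F)
  have hli : LinearIndependent ℝ (b ∘ e) := b.linearIndependent.comp e e.injective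
  refine ⟨Submodule.span ℝ (Set.range (b ∘ e)), ?_, fun h => ?_⟩
  · exact (IsSeparable.span (Set.countable_range (b ∘ e)).isSeparable).separableSpace
  · have := Module.Finite.finite_basis (Module.Basis.span hli)
    exact not_finite ℕ

/-- The Josefson–Nissenzweig theorem for reflexive spaces. -/
theorem exists_unit_weakStar_null (hinf : ¬ FiniteDimensional ℝ E) (hrefl : IsReflexiveSpace E) :
    ∃ g : ℕ → E →L[ℝ] ℝ, (∀ n, ‖g n‖ = 1) ∧ ∀ x, Tendsto (fun n => g n x) atTop (𝓝 0) := by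
  obtain ⟨V, hsep, hV⟩ := exists_separable_submodule (not_finiteDimensional_dual hinf)
  obtain ⟨z, hz⟩ := exists_separating_sequence V
  have hg : ∀ n : ℕ, ∃ g : E →L[ℝ] ℝ, g ∈ V ∧ ‖g‖ = 1 ∧ ∀ k < n, g (z k) = 0 := by
    intro n
    let φ : V →ₗ[ℝ] (Fin n → ℝ) :=
      { toFun := fun f k => (f : E →L[ℝ] ℝ) (z k)
        map_add' := fun _ _ => rfl
        map_smul' := fun _ _ => rfl }
    have hφ : ¬ Function.Injective φ := fun h => hV (FiniteDimensional.of_injective φ h)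
    rw [← LinearMap.ker_eq_bot, Submodule.eq_bot_iff] at hφ
    push Not at hφ
    obtain ⟨f, hf, hf0⟩ := hφ
    have hne : (f : E →L[ℝ] ℝ) ≠ 0 := fun h => hf0 (Subtype.ext h)
    refine ⟨‖(f : E →L[ℝ] ℝ)‖⁻¹ • (f : E →L[ℝ] ℝ), V.smul_mem _ f.2, ?_, fun k hk => ?_⟩
    · rw [norm_smul, norm_inv, norm_norm, inv_mul_cancel₀ (norm_ne_zero_iff.2 hne)]
    · have : (f : E →L[ℝ] ℝ) (z k) = 0 := congrFun (LinearMap.mem_ker.1 hf) ⟨k, hk⟩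
      simp [this]
  choose g hgV hg1 hgz using hg
  refine ⟨g, hg1, fun x => tendsto_iff_ultrafilter _ _ _ |>.2 fun U hU => ?_⟩
  obtain ⟨h, hh⟩ := exists_tendsto_apply_of_norm_le U g (C := 1) fun n => (hg1 n).le
  have hmem : h ∈ V.topologicalClosure := by
    by_contra hnot
    obtain ⟨Φ, hΦ, hΦh⟩ := exists_dual_eq_zero_of_notMem V.isClosed_topologicalClosure hnot
    obtain ⟨y, hy⟩ := hrefl Φ
    have hev : ∀ f : E →L[ℝ] ℝ, Φ f = f y := fun f => by
      rw [← hy]; rfl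
    refine hΦh ?_
    rw [hev]
    refine tendsto_nhds_unique (hh y) (tendsto_const_nhds.congr fun n => ?_)
    rw [← hev, hΦ _ (V.le_topologicalClosure (hgV n))]
  have h0 : h = 0 := by
    refine hz h hmem fun k => tendsto_nhds_unique (hh (z k)) ?_
    refine Tendsto.congr' ?_ tendsto_const_nhds
    filter_upwards [hU (eventually_gt_atTop k)] with n hn using (hgz n k hn).symm
  simpa [h0] using hh x

end WeakStarLimits

section EllInfty

variable {E : Type*} [NormedAddCommGroup E] [NormedSpace ℝ E]

/-- The operator into `ℓ∞` whose coordinates are a given bounded sequence of functionals. -/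
theorem exists_ellInfty_operator (f : ℕ → E →L[ℝ] ℝ) (hf : ∀ n, ‖f n‖ ≤ 1) :
    ∃ T : E →L[ℝ] lp (fun _ : ℕ => ℝ) ∞, ‖T‖ ≤ 1 ∧ ∀ x n, T x n = f n x := by
  have hb : ∀ x n, ‖f n x‖ ≤ ‖x‖ := fun x n => (f n).le_of_opNorm_le (hf n) x |>.trans (by simp)
  let L : E →ₗ[ℝ] lp (fun _ : ℕ => ℝ) ∞ :=
    { toFun := fun x => ⟨fun n => f n x, memℓp_infty ⟨‖x‖, by rintro _ ⟨n, rfl⟩; exact hb x n⟩⟩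
      map_add' := fun x y => by ext n; exact map_add (f n) x y
      map_smul' := fun c x => by ext n; exact map_smul (f n) c x }
  have hL : ∀ x, ‖L x‖ ≤ 1 * ‖x‖ := fun x => by
    rw [one_mul]
    exact lp.norm_le_of_forall_le (norm_nonneg x) (hb x)
  exact ⟨L.mkContinuous 1 hL, L.mkContinuous_norm_le zero_le_one hL, fun _ _ => rfl⟩

theorem WMP.weaklyNull_of_norm_lt_one (hW : WMP E (lp (fun _ : ℕ => ℝ) ∞)) {f : ℕ → E →L[ℝ] ℝ}
    {u : E →L[ℝ] ℝ} (hf : ∀ n, ‖f n‖ < 1) (hfu : ∀ x, Tendsto (fun n => f n x) atTop (𝓝 (u x)))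
    (hu : ‖u‖ < 1) {x : ℕ → E} (hx : ∀ n, ‖x n‖ = 1)
    (hfx : Tendsto (fun n => f n (x n)) atTop (𝓝 1)) : WeaklyNull x := by
  by_contra hnull
  obtain ⟨T, hT1, hT⟩ := exists_ellInfty_operator f fun n => (hf n).le
  have hlow : ∀ n, f n (x n) ≤ ‖T (x n)‖ := fun n => by
    rw [← hT]
    exact (le_abs_self _).trans (lp.norm_apply_le_norm ENNReal.top_ne_zero (T (x n)) n)
  have hup : ∀ n, ‖T (x n)‖ ≤ ‖T‖ := fun n => T.unit_le_opNorm _ (hx n).le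
  have hTn : ‖T‖ = 1 :=
    le_antisymm hT1 (le_of_tendsto' hfx fun n => (hlow n).trans (hup n))
  obtain ⟨y, hy, hTy⟩ := hW T ⟨x, hx, by
    rw [hTn] at hup ⊢
    exact tendsto_of_tendsto_of_tendsto_of_le_of_le hfx tendsto_const_nhds hlow hup, hnull⟩
  rw [hTn] at hTy
  have hlim : Tendsto (fun n => |f n y|) atTop (𝓝 |u y|) := (hfu y).abs
  have huy : |u y| < 1 := (u.unit_le_opNorm y hy).trans_lt hu
  obtain ⟨c, hc1, hc2⟩ := exists_between huy
  obtain ⟨N, hN⟩ := eventually_atTop.1 (hlim.eventually_lt_const hc1)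
  have hfin : ∀ N : ℕ, ∃ d < (1 : ℝ), ∀ n < N, |f n y| ≤ d := by
    intro N
    induction N with
    | zero => exact ⟨0, zero_lt_one, by simp⟩
    | succ N ih =>
      obtain ⟨d, hd, hd'⟩ := ih
      refine ⟨max d |f N y|, max_lt hd (((f N).unit_le_opNorm y hy).trans_lt (hf N)), ?_⟩
      intro n hn
      rcases Nat.lt_succ_iff_lt_or_eq.1 hn with h | rfl
      · exact (hd' n h).trans (le_max_left _ _)
      · exact le_max_right _ _
  obtain ⟨d, hd, hd'⟩ := hfin N
  have : ‖T y‖ ≤ max c d := by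
    refine lp.norm_le_of_forall_le ((abs_nonneg _).trans (hc1.le.trans (le_max_left _ _)))
      fun n => ?_
    rw [hT, Real.norm_eq_abs]
    rcases lt_or_ge n N with h | h
    · exact (hd' n h).trans (le_max_right _ _)
    · exact (hN n h).le.trans (le_max_left _ _)
  exact absurd (hTy ▸ this) (not_le.2 (max_lt hc2 hd))

theorem WMP.weaklyNull_of_norm_lt (hW : WMP E (lp (fun _ : ℕ => ℝ) ∞)) {f : ℕ → E →L[ℝ] ℝ}
    {u : E →L[ℝ] ℝ} {r : ℝ} (hfr : Tendsto (fun n => ‖f n‖) atTop (𝓝 r))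
    (hfu : ∀ x, Tendsto (fun n => f n x) atTop (𝓝 (u x))) (hu : ‖u‖ < r)
    {x : ℕ → E} (hx : ∀ n, ‖x n‖ = 1)
    (hfx : Tendsto (fun n => f n (x n)) atTop (𝓝 r)) : WeaklyNull x := by
  have hr : 0 < r := (norm_nonneg u).trans_lt hu
  let a : ℕ → ℝ := fun n => (1 - 1 / ((n : ℝ) + 1 + 1)) * ‖f n‖⁻¹
  have hpos : ∀ n : ℕ, 0 < 1 / ((n : ℝ) + 1 + 1) := fun n => by positivity
  have hle : ∀ n : ℕ, 1 / ((n : ℝ) + 1 + 1) < 1 := fun n => by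
    rw [div_lt_one (by positivity)]; linarith [n.cast_nonneg (α := ℝ)]
  have ha : Tendsto a atTop (𝓝 r⁻¹) := by
    have h1 : Tendsto (fun n : ℕ => 1 / ((n : ℝ) + 1 + 1)) atTop (𝓝 0) := by
      have := (tendsto_one_div_add_atTop_nhds_zero_nat (𝕜 := ℝ)).comp (tendsto_add_atTop_nat 1)
      refine this.congr fun n => ?_
      simp
    simpa [a] using (h1.const_sub 1).mul (hfr.inv₀ hr.ne')
  refine hW.weaklyNull_of_norm_lt_one (f := fun n => a n • f n) (u := r⁻¹ • u)
    (fun n => ?_) (fun y => ?_) ?_ hx ?_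
  · rw [norm_smul, Real.norm_of_nonneg (mul_nonneg (by linarith [hle n]) (by positivity)),
      mul_assoc]
    have h1 : ‖f n‖⁻¹ * ‖f n‖ ≤ 1 := inv_mul_le_one
    nlinarith [hpos n, hle n]
  · exact ha.mul (hfu y)
  · rw [norm_smul, norm_inv, Real.norm_of_nonneg hr.le, inv_mul_lt_iff₀ hr]
    simpa using hu
  · simpa [inv_mul_cancel₀ hr.ne'] using ha.mul hfx

/-- Under the weak maximizing property, weak-star null sequences in the dual are asymptotically
combined with a fixed functional as in `c₀`. -/
theorem WMP.eventually_norm_add_lt (hE : Nontrivial E) (hW : WMP E (lp (fun _ : ℕ => ℝ) ∞))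
    {g : ℕ → E →L[ℝ] ℝ} {u : E →L[ℝ] ℝ} {c d : ℝ} (hg : ∀ n, ‖g n‖ ≤ c)
    (hg0 : ∀ x, Tendsto (fun n => g n x) atTop (𝓝 0)) (hu : ‖u‖ ≤ c) (hcd : c < d) :
    ∀ᶠ n in atTop, ‖u + g n‖ < d := by
  by_contra hnot
  have hfreq : ∃ᶠ n in atTop, ‖u + g n‖ ∈ Set.Icc d (c + c) := by
    refine (not_eventually.1 hnot).mono fun n hn => ⟨not_lt.1 hn, ?_⟩
    exact (norm_add_le _ _).trans (add_le_add hu (hg n))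
  obtain ⟨r, hr, φ, hφ, hlim⟩ := isCompact_Icc.tendsto_subseq' hfreq
  have hex : ∀ k : ℕ, ∃ x : E, ‖x‖ = 1 ∧
      ‖u + g (φ k)‖ - 1 / ((k : ℝ) + 1) < (u + g (φ k)) x := fun k =>
    exists_norm_eq_one_lt_apply hE _ (sub_lt_self _ (by positivity))
  choose x hx hlt using hex
  have hval : Tendsto (fun k => (u + g (φ k)) (x k)) atTop (𝓝 r) := by
    refine tendsto_of_tendsto_of_tendsto_of_le_of_le ?_ hlim (fun k => (hlt k).le)
      fun k => (le_abs_self _).trans ((u + g (φ k)).unit_le_opNorm _ (hx k).le)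
    simpa using hlim.sub (tendsto_one_div_add_atTop_nhds_zero_nat (𝕜 := ℝ))
  have hnull : WeaklyNull x := by
    refine hW.weaklyNull_of_norm_lt (u := u) hlim (fun y => ?_) (by linarith [hr.1]) hx hval
    simpa using ((hg0 y).comp hφ.tendsto_atTop).const_add (u y)
  have hgr : Tendsto (fun k => g (φ k) (x k)) atTop (𝓝 r) := by
    simpa using hval.sub (hnull u)
  have : r ≤ c := le_of_tendsto' hgr fun k =>
    (le_abs_self _).trans (((g (φ k)).unit_le_opNorm _ (hx k).le).trans (hg _))
  linarith [hr.1]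

theorem not_WMP_of_unit_weakStar_null (hE : Nontrivial E) {g : ℕ → E →L[ℝ] ℝ}
    (hg : ∀ n, ‖g n‖ = 1) (hg0 : ∀ x, Tendsto (fun n => g n x) atTop (𝓝 0)) :
    ¬ WMP E (lp (fun _ : ℕ => ℝ) ∞) := by
  intro hW
  have hex : ∀ k : ℕ, ∃ x : E, ‖x‖ = 1 ∧ 1 - 1 / ((k : ℝ) + 1) < g k x := fun k =>
    exists_norm_eq_one_lt_apply hE _ (by rw [hg]; exact sub_lt_self _ (by positivity))
  choose x hx hlt using hex
  have hgx : Tendsto (fun k => g k (x k)) atTop (𝓝 1) := by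
    refine tendsto_of_tendsto_of_tendsto_of_le_of_le ?_ tendsto_const_nhds (fun k => (hlt k).le)
      fun k => (le_abs_self _).trans (((g k).unit_le_opNorm _ (hx k).le).trans (hg k).le)
    simpa using (tendsto_one_div_add_atTop_nhds_zero_nat (𝕜 := ℝ)).const_sub 1
  have hnull : WeaklyNull x :=
    hW.weaklyNull_of_norm_lt (u := 0) (r := 1) (by simp [hg]) (by simpa using hg0) (by simp) hx hgx
  let P : Finset ℕ → Prop := fun s =>
    ‖∑ i ∈ s, g i‖ < 2 ∧ ∀ i ∈ s, 1 / 2 < (∑ j ∈ s, g j) (x i)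
  have hstep : ∀ s, P s → ∀ N, ∃ n, N ≤ n ∧ P (insert n s) := by
    rintro s ⟨hs1, hs2⟩ N
    set u := ∑ i ∈ s, g i
    have e1 : ∀ᶠ n in atTop, ‖u + g n‖ < 2 :=
      hW.eventually_norm_add_lt hE (c := max ‖u‖ 1) (fun n => (hg n).trans_le (le_max_right _ _))
        hg0 (le_max_left _ _) (max_lt hs1 one_lt_two)
    have e2 : ∀ᶠ n in atTop, ∀ i ∈ s, 1 / 2 < (u + g n) (x i) := by
      rw [Filter.eventually_all_finset]
      intro i hi
      have : Tendsto (fun n => (u + g n) (x i)) atTop (𝓝 (u (x i))) := by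
        simpa using (hg0 (x i)).const_add (u (x i))
      exact this.eventually_const_lt (hs2 i hi)
    have e3 : ∀ᶠ n in atTop, 1 / 2 < (u + g n) (x n) := by
      have : Tendsto (fun n => (u + g n) (x n)) atTop (𝓝 1) := by
        simpa using (hnull u).add hgx
      exact this.eventually_const_lt (by norm_num)
    have e4 : ∀ᶠ n in atTop, n ∉ s := by
      filter_upwards [eventually_gt_atTop (s.sup id)] with n hn hns
      exact hn.not_ge (Finset.le_sup (f := id) hns)
    obtain ⟨n, h1, h2, h3, h4, h5⟩ :=
      (e1.and (e2.and (e3.and (e4.and (eventually_ge_atTop N))))).exists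
    have hsum : ∑ i ∈ insert n s, g i = u + g n := by rw [Finset.sum_insert h4, add_comm]
    refine ⟨n, h5, ?_, ?_⟩
    · rwa [hsum]
    · rw [hsum]
      exact Finset.forall_mem_insert _ _ _ |>.2 ⟨h3, h2⟩
  choose! next hnext_ge hnext using hstep
  let S : ℕ → Finset ℕ := fun k => Nat.rec ∅ (fun k s => insert (next s k) s) k
  have hS : ∀ k, S (k + 1) = insert (next (S k) k) (S k) := fun _ => rfl
  have hP : ∀ k, P (S k) := by
    intro k
    induction k with
    | zero => simp [S, P]
    | succ k ih => exact hS k ▸ hnext _ ih k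
  have hmono : Monotone S := monotone_nat_of_le_succ fun k => hS k ▸ Finset.subset_insert _ _
  obtain ⟨h, hh⟩ := exists_tendsto_apply_of_norm_le (hyperfilter ℕ) (fun k => ∑ i ∈ S k, g i)
    (C := 2) fun k => (hP k).1.le
  obtain ⟨N, hN⟩ := eventually_atTop.1
    ((hnull h).eventually_lt_const (show (0 : ℝ) < 1 / 2 by norm_num))
  have hlow : 1 / 2 ≤ h (x (next (S N) N)) := by
    refine ge_of_tendsto (hh _) ?_
    filter_upwards [Nat.hyperfilter_le_atTop (eventually_ge_atTop (N + 1))] with k hk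
    exact ((hP k).2 _ (hmono hk (hS N ▸ Finset.mem_insert_self _ _))).le
  exact hlow.not_gt (hN _ (hnext_ge _ (hP N) N))

end EllInfty

theorem pair_with_ell_infty_fails_WMP
    (X : Type*) [NormedAddCommGroup X] [NormedSpace ℝ X] [CompleteSpace X]
    (hinf : ¬ FiniteDimensional ℝ X) (hrefl : IsReflexiveSpace X) :
    ¬ WMP X (lp (fun _ : ℕ => ℝ) ∞) := by
  have hE : Nontrivial X := by
    by_contra h
    rw [not_nontrivial_iff_subsingleton] at h
    exact hinf inferInstance
  obtain ⟨g, hg, hg0⟩ := exists_unit_weakStar_null hinf hrefl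
  exact not_WMP_of_unit_weakStar_null hE hg hg0
end
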